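/- arXiv:1812.04827 — 8 statements merged into one kernel-verified Lean document; each statement's English description precedes it below -/
import Mathlib

section
/- Let X and Y be two continuously distributed random variables on an atomless probability space (Ω, F, ℙ), and let p ∈ (0,1). Then the following three statements are equivalent (with a.s.-equal random variables treated as identical, i.e. the weak comonotonicity statements hold for a suitable representative pair): (i) X and Y are weakly comonotonic with respect to P^X_p; (ii) X and Y are weakly comonotonic with respect to P^Y_p; (iii) A^X_p = A^Y_p ℙ-almost surely. -/
open MeasureTheory Set

/-- Value-at-Risk at level `p`: `VaR_p(X) = inf {x ∈ ℝ : ℙ(X ≤ x) > p}`. -/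
noncomputable def VaR {Ω : Type*} [MeasurableSpace Ω] (μ : Measure Ω) (X : Ω → ℝ) (p : ℝ) : ℝ :=
  sInf {x : ℝ | p < (μ {ω | X ω ≤ x}).toReal}

/-- The upper-tail event `A^X_p = {ω ∈ Ω : X ω > VaR_p(X)}`. -/
def tailSet {Ω : Type*} [MeasurableSpace Ω] (μ : Measure Ω) (X : Ω → ℝ) (p : ℝ) : Set Ω :=
  {ω | VaR μ X p < X ω}

/-- `X` is continuously distributed under `μ`. -/
def ContinuouslyDistributed {Ω : Type*} [MeasurableSpace Ω] (μ : Measure Ω) (X : Ω → ℝ) : Prop :=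
  ∀ x : ℝ, μ {ω | X ω = x} = 0

/-- `μ` is an atomless measure: every non-null measurable set has a measurable subset of
strictly smaller positive measure. -/
def Atomless {Ω : Type*} [MeasurableSpace Ω] (μ : Measure Ω) : Prop :=
  ∀ s : Set Ω, MeasurableSet s → 0 < μ s →
    ∃ t ⊆ s, MeasurableSet t ∧ 0 < μ t ∧ μ t < μ s

/-- `X` and `Y` are weakly comonotonic with respect to the product measure `π₁ × π₂`:
`∬ (X ω − X ω')(Y ω − Y ω') π₁(dω) π₂(dω') ≥ 0`. -/
def WeaklyComonotonic {Ω : Type*} [MeasurableSpace Ω] (X Y : Ω → ℝ)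
    (π₁ π₂ : Measure Ω) : Prop :=
  0 ≤ ∫ q : Ω × Ω, (X q.1 - X q.2) * (Y q.1 - Y q.2) ∂(π₁.prod π₂)

/-- `X` and `Y` are weakly antimonotonic with respect to the product measure `π₁ × π₂`:
`∬ (X ω − X ω')(Y ω − Y ω') π₁(dω) π₂(dω') ≤ 0`. -/
def WeaklyAntimonotonic {Ω : Type*} [MeasurableSpace Ω] (X Y : Ω → ℝ)
    (π₁ π₂ : Measure Ω) : Prop :=
  ∫ q : Ω × Ω, (X q.1 - X q.2) * (Y q.1 - Y q.2) ∂(π₁.prod π₂) ≤ 0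

open Filter Topology

section TailSet

variable {Ω : Type*} [MeasurableSpace Ω] {μ : Measure Ω} {X Y X' : Ω → ℝ} {p : ℝ}

theorem weaklyComonotonic_dirac_iff (hX : Measurable X) (hY : Measurable Y) (ω ω' : Ω) :
    WeaklyComonotonic X Y (Measure.dirac ω) (Measure.dirac ω') ↔
      0 ≤ (X ω - X ω') * (Y ω - Y ω') := by
  have hm : Measurable fun q : Ω × Ω => (X q.1 - X q.2) * (Y q.1 - Y q.2) := by fun_prop
  rw [WeaklyComonotonic, Measure.dirac_prod_dirac, integral_dirac' _ _ hm.stronglyMeasurable]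

theorem weaklyComonotonic_comm {π₁ π₂ : Measure Ω} :
    WeaklyComonotonic X Y π₁ π₂ ↔ WeaklyComonotonic Y X π₁ π₂ := by
  simp only [WeaklyComonotonic, mul_comm]

theorem VaR_congr_ae (h : X' =ᵐ[μ] X) : VaR μ X' p = VaR μ X p := by
  have hle (x : ℝ) : μ {ω | X' ω ≤ x} = μ {ω | X ω ≤ x} := by
    refine measure_congr ?_
    filter_upwards [h] with ω hω
    exact congrArg (· ≤ x) hω
  simp only [VaR, hle]

theorem tailSet_congr_ae (h : X' =ᵐ[μ] X) : tailSet μ X' p =ᵐ[μ] tailSet μ X p := by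
  filter_upwards [h] with ω hω
  change (VaR μ X' p < X' ω) = (VaR μ X p < X ω)
  rw [VaR_congr_ae h, hω]

theorem ContinuouslyDistributed.congr_ae (hX : ContinuouslyDistributed μ X) (h : X' =ᵐ[μ] X) :
    ContinuouslyDistributed μ X' := by
  intro x
  rw [← hX x]
  refine measure_congr ?_
  filter_upwards [h] with ω hω
  exact congrArg (· = x) hω

theorem measurableSet_tailSet (hX : Measurable X) : MeasurableSet (tailSet μ X p) :=
  measurableSet_lt measurable_const hX

theorem exists_weaklyComonotonic_of_tailSet_ae_eq (hX : Measurable X) (hY : Measurable Y)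
    (h : tailSet μ X p =ᵐ[μ] tailSet μ Y p) :
    ∃ X' Y' : Ω → ℝ, Measurable X' ∧ Measurable Y' ∧ X' =ᵐ[μ] X ∧ Y' =ᵐ[μ] Y ∧
      ∀ ω ∈ tailSet μ X' p, ∀ ω' ∉ tailSet μ X' p,
        WeaklyComonotonic X' Y' (Measure.dirac ω) (Measure.dirac ω') := by
  classical
  set A := tailSet μ X p with hA
  set B := tailSet μ Y p with hB
  set N : Set Ω := symmDiff A B
  have hNm : MeasurableSet N := (measurableSet_tailSet hX).symmDiff (measurableSet_tailSet hY)
  have hN : ∀ᵐ ω ∂μ, ω ∉ N := measure_eq_zero_iff_ae_notMem.1 (measure_symmDiff_eq_zero_iff.2 h)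
  have hX' : N.piecewise (fun _ => VaR μ X p) X =ᵐ[μ] X := by
    filter_upwards [hN] with ω hω
    exact piecewise_eq_of_notMem _ _ _ hω
  have hY' : N.piecewise (fun _ => VaR μ Y p) Y =ᵐ[μ] Y := by
    filter_upwards [hN] with ω hω
    exact piecewise_eq_of_notMem _ _ _ hω
  have hXm : Measurable (N.piecewise (fun _ => VaR μ X p) X) := measurable_const.piecewise hNm hX
  have hYm : Measurable (N.piecewise (fun _ => VaR μ Y p) Y) := measurable_const.piecewise hNm hY
  refine ⟨_, _, hXm, hYm, hX', hY', fun ω hω ω' hω' => ?_⟩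
  rw [weaklyComonotonic_dirac_iff hXm hYm]
  simp only [tailSet, mem_ofPred_eq, VaR_congr_ae hX'] at hω hω'
  have hωN : ω ∉ N := fun hmem => by simp [hmem] at hω
  have hYω : VaR μ Y p < N.piecewise (fun _ => VaR μ Y p) Y ω := by
    simp only [hωN, not_false_eq_true, piecewise_eq_of_notMem] at hω ⊢
    by_contra hlt
    exact hωN (Or.inl ⟨hω, hlt⟩)
  have hYω' : N.piecewise (fun _ => VaR μ Y p) Y ω' ≤ VaR μ Y p := by
    by_cases hmem : ω' ∈ N
    · simp [hmem]
    · simp only [hmem, not_false_eq_true, piecewise_eq_of_notMem] at hω' ⊢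
      by_contra hlt
      exact hmem (Or.inr ⟨not_le.1 hlt, hω'⟩)
  exact mul_nonneg (by linarith [not_lt.1 hω']) (by linarith)

variable [IsProbabilityMeasure μ]

theorem measureReal_le_VaR (hp : p ∈ Set.Ioo (0 : ℝ) 1) (hX : Measurable X)
    (hXc : ContinuouslyDistributed μ X) : μ.real {ω | X ω ≤ VaR μ X p} = p := by
  have : IsProbabilityMeasure (μ.map X) := Measure.isProbabilityMeasure_map hX.aemeasurable
  set F := ProbabilityTheory.cdf (μ.map X) with hF
  have hFX (x : ℝ) : F x = μ.real {ω | X ω ≤ x} := by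
    rw [hF, ProbabilityTheory.cdf_eq_real, map_measureReal_apply hX measurableSet_Iic]
    rfl
  set S : Set ℝ := {x | p < F x} with hS
  have hVaR : VaR μ X p = sInf S := by
    simp only [hS, hFX]
    rfl
  have hne : S.Nonempty :=
    ((ProbabilityTheory.tendsto_cdf_atTop (μ.map X)).eventually_const_lt hp.2).exists
  have hbdd : BddBelow S := by
    obtain ⟨b, hb⟩ :=
      ((ProbabilityTheory.tendsto_cdf_atBot (μ.map X)).eventually_lt_const hp.1).exists
    refine ⟨b, fun x hx => le_of_not_gt fun hxb => ?_⟩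
    exact absurd (hx.trans_le (F.mono hxb.le)) (not_lt.2 hb.le)
  rw [← hFX, hVaR]
  refine le_antisymm ?_ ?_
  · have hleft : Function.leftLim F (sInf S) ≤ p := by
      refine le_of_tendsto (F.mono.tendsto_leftLim _) ?_
      filter_upwards [self_mem_nhdsWithin] with x hx
      exact le_of_not_gt fun h => notMem_of_lt_csInf hx hbdd h
    have hatom : F.measure {sInf S} = 0 := by
      rw [hF, ProbabilityTheory.measure_cdf, Measure.map_apply hX (measurableSet_singleton _)]
      exact hXc _
    rw [StieltjesFunction.measure_singleton, ENNReal.ofReal_eq_zero] at hatom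
    linarith
  · have hright : Tendsto F (𝓝[>] (sInf S)) (𝓝 (F (sInf S))) :=
      (F.right_continuous _).tendsto.mono_left (nhdsWithin_mono _ Ioi_subset_Ici_self)
    refine ge_of_tendsto hright ?_
    filter_upwards [self_mem_nhdsWithin] with x hx
    obtain ⟨y, hy, hyx⟩ := exists_lt_of_csInf_lt hne hx
    exact (hy.trans_le (F.mono hyx.le)).le

theorem measureReal_tailSet (hp : p ∈ Set.Ioo (0 : ℝ) 1) (hX : Measurable X)
    (hXc : ContinuouslyDistributed μ X) : μ.real (tailSet μ X p) = 1 - p := by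
  have hcompl : tailSet μ X p = {ω | X ω ≤ VaR μ X p}ᶜ := by
    ext ω
    simp [tailSet]
  rw [hcompl, probReal_compl_eq_one_sub (measurableSet_le hX measurable_const),
    measureReal_le_VaR hp hX hXc]

theorem superlevel_ae_eq_of_measureReal_eq (hY : Measurable Y) {a b : ℝ}
    (h : μ.real {ω | a < Y ω} = μ.real {ω | b < Y ω}) :
    ({ω | a < Y ω} : Set Ω) =ᵐ[μ] {ω | b < Y ω} := by
  wlog hab : a ≤ b generalizing a b
  · exact (this h.symm (le_of_not_ge hab)).symm
  have h' : μ {ω | a < Y ω} = μ {ω | b < Y ω} := (measureReal_eq_measureReal_iff).1 h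
  exact (ae_eq_of_subset_of_measure_ge (fun ω hω => lt_of_le_of_lt hab hω) h'.le
    (measurableSet_lt measurable_const hY).nullMeasurableSet (measure_ne_top _ _)).symm

theorem tailSet_ae_eq_of_weaklyComonotonic (hp : p ∈ Set.Ioo (0 : ℝ) 1)
    (hX : Measurable X) (hY : Measurable Y)
    (hXc : ContinuouslyDistributed μ X) (hYc : ContinuouslyDistributed μ Y)
    (h : ∀ ω ∈ tailSet μ X p, ∀ ω' ∉ tailSet μ X p,
      WeaklyComonotonic X Y (Measure.dirac ω) (Measure.dirac ω')) :
    tailSet μ X p =ᵐ[μ] tailSet μ Y p := by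
  have hle : ∀ ω ∈ tailSet μ X p, ∀ ω' ∉ tailSet μ X p, Y ω' ≤ Y ω := by
    intro ω hω ω' hω'
    have hlt : X ω' < X ω := lt_of_le_of_lt (not_lt.1 hω') hω
    have hnonneg := (weaklyComonotonic_dirac_iff hX hY ω ω').1 (h ω hω ω' hω')
    exact sub_nonneg.1 (nonneg_of_mul_nonneg_right hnonneg (sub_pos.2 hlt))
  have hA : μ.real (tailSet μ X p) = 1 - p := measureReal_tailSet hp hX hXc
  have hne : (tailSet μ X p).Nonempty := by
    rw [nonempty_iff_ne_empty]
    intro he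
    rw [he, measureReal_empty] at hA
    linarith [hp.2]
  obtain ⟨ω₀, hω₀⟩ : ∃ ω, ω ∉ tailSet μ X p := by
    by_contra! hall
    rw [eq_univ_of_forall hall, probReal_univ] at hA
    linarith [hp.1]
  set c := sInf (Y '' tailSet μ X p)
  have hc : tailSet μ X p =ᵐ[μ] {ω | c < Y ω} := by
    have hYne : ∀ᵐ ω ∂μ, Y ω ≠ c := by
      rw [ae_iff]
      simpa using hYc c
    filter_upwards [hYne] with ω hω
    refine propext ⟨fun hmem => lt_of_le_of_ne ?_ hω.symm, fun hlt => ?_⟩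
    · refine csInf_le ⟨Y ω₀, ?_⟩ (mem_image_of_mem Y hmem)
      rintro _ ⟨ω₁, hω₁, rfl⟩
      exact hle ω₁ hω₁ ω₀ hω₀
    · by_contra hmem
      refine absurd hlt (not_lt.2 (le_csInf (hne.image Y) ?_))
      rintro _ ⟨ω₁, hω₁, rfl⟩
      exact hle ω₁ hω₁ ω hmem
  refine hc.trans (superlevel_ae_eq_of_measureReal_eq hY ?_)
  rw [← measureReal_congr hc, hA]
  exact (measureReal_tailSet hp hY hYc).symm

theorem exists_weaklyComonotonic_iff_tailSet_ae_eq (hp : p ∈ Set.Ioo (0 : ℝ) 1)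
    (hX : Measurable X) (hY : Measurable Y)
    (hXc : ContinuouslyDistributed μ X) (hYc : ContinuouslyDistributed μ Y) :
    (∃ X' Y' : Ω → ℝ, Measurable X' ∧ Measurable Y' ∧ X' =ᵐ[μ] X ∧ Y' =ᵐ[μ] Y ∧
      ∀ ω ∈ tailSet μ X' p, ∀ ω' ∉ tailSet μ X' p,
        WeaklyComonotonic X' Y' (Measure.dirac ω) (Measure.dirac ω')) ↔
      tailSet μ X p =ᵐ[μ] tailSet μ Y p := by
  refine ⟨?_, exists_weaklyComonotonic_of_tailSet_ae_eq hX hY⟩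
  rintro ⟨X', Y', hXm, hYm, hXX, hYY, h⟩
  exact (tailSet_congr_ae hXX).symm.trans <|
    (tailSet_ae_eq_of_weaklyComonotonic hp hXm hYm (hXc.congr_ae hXX) (hYc.congr_ae hYY) h).trans
      (tailSet_congr_ae hYY)

end TailSet

/-- Lemma 3.1 (Wang–Zitikis, "Weak comonotonicity"). For continuously distributed random
variables `X, Y` on an atomless probability space and `p ∈ (0,1)`, the following are
equivalent (weak comonotonicity statements being understood for a representative pair of
a.s.-equal random variables): (i) `X` and `Y` are weakly comonotonic w.r.t. `𝒫^X_p`;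
(ii) `X` and `Y` are weakly comonotonic w.r.t. `𝒫^Y_p`; (iii) `A^X_p = A^Y_p` a.s. -/
theorem weaklyComonotonic_tail_iff_tail_ae_eq {Ω : Type*} [MeasurableSpace Ω]
    (μ : Measure Ω) [IsProbabilityMeasure μ] (hμ : Atomless μ)
    (p : ℝ) (hp : p ∈ Set.Ioo (0 : ℝ) 1)
    (X Y : Ω → ℝ) (hX : Measurable X) (hY : Measurable Y)
    (hXc : ContinuouslyDistributed μ X) (hYc : ContinuouslyDistributed μ Y) :
    ((∃ X' Y' : Ω → ℝ, Measurable X' ∧ Measurable Y' ∧ X' =ᵐ[μ] X ∧ Y' =ᵐ[μ] Y ∧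
        ∀ ω ∈ tailSet μ X' p, ∀ ω' ∉ tailSet μ X' p,
          WeaklyComonotonic X' Y' (Measure.dirac ω) (Measure.dirac ω')) ↔
      ((tailSet μ X p : Set Ω) =ᵐ[μ] (tailSet μ Y p : Set Ω))) ∧
    ((∃ X' Y' : Ω → ℝ, Measurable X' ∧ Measurable Y' ∧ X' =ᵐ[μ] X ∧ Y' =ᵐ[μ] Y ∧
        ∀ ω ∈ tailSet μ Y' p, ∀ ω' ∉ tailSet μ Y' p,
          WeaklyComonotonic X' Y' (Measure.dirac ω) (Measure.dirac ω')) ↔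
      ((tailSet μ X p : Set Ω) =ᵐ[μ] (tailSet μ Y p : Set Ω))) := by
  refine ⟨exists_weaklyComonotonic_iff_tailSet_ae_eq hp hX hY hXc hYc, ?_⟩
  refine Iff.trans ?_ ((exists_weaklyComonotonic_iff_tailSet_ae_eq hp hY hX hYc hXc).trans
    ⟨fun h => h.symm, fun h => h.symm⟩)
  constructor
  · rintro ⟨X', Y', hXm, hYm, hXX, hYY, h⟩
    exact ⟨Y', X', hYm, hXm, hYY, hXX,
      fun ω hω ω' hω' => weaklyComonotonic_comm.1 (h ω hω ω' hω')⟩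
  · rintro ⟨Y', X', hYm, hXm, hYY, hXX, h⟩
    exact ⟨X', Y', hXm, hYm, hXX, hYY,
      fun ω hω ω' hω' => weaklyComonotonic_comm.1 (h ω hω ω' hω')⟩
end

section
/- Let g, h : ℝ → ℝ be Borel functions. Then R_{g,h} = R_a (i.e., the only product measures with respect to which g and h are weakly comonotonic are the diagonal point masses δ_x × δ_x, x ∈ ℝ) if and only if g and h are strongly antimonotonic and both injective on ℝ. -/
open MeasureTheory Set

/-- `ℛ_{g,h}`: the set of all product (probability) measures `ρ₁ × ρ₂` on `ℝ²` with
respect to which `g` and `h` are weakly comonotonic (the defining integral existing). -/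
def RSet (g h : ℝ → ℝ) : Set (Measure (ℝ × ℝ)) :=
  {ρ | ∃ ρ₁ ρ₂ : Measure ℝ, IsProbabilityMeasure ρ₁ ∧ IsProbabilityMeasure ρ₂ ∧
      ρ = ρ₁.prod ρ₂ ∧
      Integrable (fun q : ℝ × ℝ => (g q.1 - g q.2) * (h q.1 - h q.2)) (ρ₁.prod ρ₂) ∧
      WeaklyComonotonic g h ρ₁ ρ₂}

/-- A probability measure almost every point of which equals `a` is the point mass at `a`. -/
lemma eq_dirac_of_ae_eq {μ : Measure ℝ} [IsProbabilityMeasure μ] {a : ℝ}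
    (h : ∀ᵐ y ∂μ, y = a) : μ = Measure.dirac a := by
  have hmap : μ.map id = μ.map (fun _ => a) := Measure.map_congr h
  simpa using hmap

/-- Probability measures whose product is concentrated on the diagonal are one and the same
point mass. -/
lemma exists_eq_dirac_of_ae_prod_eq {μ ν : Measure ℝ} [IsProbabilityMeasure μ]
    [IsProbabilityMeasure ν] (h : ∀ᵐ q ∂(μ.prod ν), q.1 = q.2) :
    ∃ a : ℝ, μ = Measure.dirac a ∧ ν = Measure.dirac a := by
  have hae : ∀ᵐ x ∂μ, ∀ᵐ y ∂ν, x = y := Measure.ae_ae_of_ae_prod h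
  obtain ⟨a, ha⟩ := hae.exists
  refine ⟨a, eq_dirac_of_ae_eq ?_, eq_dirac_of_ae_eq (ha.mono fun y hy => hy.symm)⟩
  filter_upwards [hae] with x hx
  obtain ⟨y, hxy, hay⟩ := (hx.and ha).exists
  exact hxy.trans hay.symm

/-- A point `(x, y)` where the product of increments is nonnegative gives a point mass in
`RSet g h`. -/
lemma dirac_prod_dirac_mem_RSet {g h : ℝ → ℝ} {x y : ℝ}
    (hxy : 0 ≤ (g x - g y) * (h x - h y)) :
    (Measure.dirac x).prod (Measure.dirac y) ∈ RSet g h := by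
  refine ⟨Measure.dirac x, Measure.dirac y, inferInstance, inferInstance, rfl, ?_, ?_⟩
  · rw [Measure.dirac_prod_dirac]
    exact integrable_dirac enorm_lt_top
  · rw [WeaklyComonotonic, Measure.dirac_prod_dirac, integral_dirac]
    exact hxy

/-- If the product of increments is negative off the diagonal, then `RSet g h` consists of
diagonal point masses. -/
lemma exists_eq_dirac_of_mem_RSet {g h : ℝ → ℝ}
    (hneg : ∀ x y, x ≠ y → (g x - g y) * (h x - h y) < 0) {ρ : Measure (ℝ × ℝ)}
    (hρ : ρ ∈ RSet g h) : ∃ x : ℝ, ρ = (Measure.dirac x).prod (Measure.dirac x) := by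
  obtain ⟨μ, ν, _, _, rfl, hint, hcom⟩ := hρ
  have hnonpos : ∀ q : ℝ × ℝ, (g q.1 - g q.2) * (h q.1 - h q.2) ≤ 0 := fun q => by
    by_cases hq : q.1 = q.2
    · simp [hq]
    · exact (hneg _ _ hq).le
  have hzero : ∫ q : ℝ × ℝ, -((g q.1 - g q.2) * (h q.1 - h q.2)) ∂(μ.prod ν) = 0 := by
    rw [integral_neg, le_antisymm (integral_nonpos hnonpos) hcom, neg_zero]
  have hae := (integral_eq_zero_iff_of_nonneg
    (fun q => neg_nonneg.mpr (hnonpos q)) hint.neg).mp hzero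
  obtain ⟨a, rfl, rfl⟩ := exists_eq_dirac_of_ae_prod_eq (μ := μ) (ν := ν) <| by
    filter_upwards [hae] with q hq
    by_contra hne
    exact (hneg _ _ hne).ne (neg_eq_zero.mp hq)
  exact ⟨a, rfl⟩

/-- Theorem 4.1(ii) (Wang–Zitikis, "Weak comonotonicity"). `ℛ_{g,h} = ℛ_a` (the diagonal
point masses `δ_x × δ_x`) if and only if `g` and `h` are strongly antimonotonic and
injective on `ℝ`. -/
theorem RSet_eq_diagonal_iff_antimonotonic_injective
    (g h : ℝ → ℝ) (hg : Measurable g) (hh : Measurable h) :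
    RSet g h = {ρ | ∃ x : ℝ, ρ = (Measure.dirac x).prod (Measure.dirac x)} ↔
      ((∀ x x' : ℝ, (g x - g x') * (h x - h x') ≤ 0) ∧
        Function.Injective g ∧ Function.Injective h) := by
  constructor
  · intro heq
    have hneg : ∀ x y, x ≠ y → (g x - g y) * (h x - h y) < 0 := by
      intro x y hxy
      by_contra! hle
      have hmem := dirac_prod_dirac_mem_RSet hle
      rw [heq] at hmem
      obtain ⟨z, hz⟩ := hmem
      rw [Measure.dirac_prod_dirac, Measure.dirac_prod_dirac, dirac_eq_dirac_iff,
        Prod.mk.injEq] at hz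
      exact hxy (hz.1.trans hz.2.symm)
    refine ⟨fun x y => ?_, fun x y hxy => ?_, fun x y hxy => ?_⟩
    · by_cases hxy : x = y
      · simp [hxy]
      · exact (hneg x y hxy).le
    · by_contra hne
      simpa [hxy] using hneg x y hne
    · by_contra hne
      simpa [hxy] using hneg x y hne
  · rintro ⟨hanti, hginj, hhinj⟩
    ext ρ
    constructor
    · refine exists_eq_dirac_of_mem_RSet fun x y hxy => lt_of_le_of_ne (hanti x y) ?_
      exact mul_ne_zero (sub_ne_zero.mpr (hginj.ne hxy)) (sub_ne_zero.mpr (hhinj.ne hxy))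
    · rintro ⟨x, rfl⟩
      exact dirac_prod_dirac_mem_RSet (by simp)
end

section
/- Let (X, Y) be jointly Gaussian random variables on a probability space (Ω, F, ℙ), each with standard normal marginal distribution and with correlation c ∈ [−1, 1]. Then the following three statements are equivalent: (i) c ≥ 0; (ii) {ℙ_A × ℙ_B : A, B ∈ σ⁺(X)} ⊆ P_{X,Y}; (iii) {ℙ_A × ℙ_A : A ∈ σ⁺(X)} ⊆ P_{X,Y}. -/
open MeasureTheory Set

open ProbabilityTheory

/-- Expansion of the weak comonotonicity integral with respect to a product measure. -/
theorem integral_prod_sub_mul_sub {Ω : Type*} [MeasurableSpace Ω] {X Y : Ω → ℝ}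
    (π₁ π₂ : Measure Ω) [IsProbabilityMeasure π₁] [IsProbabilityMeasure π₂]
    (hX₁ : MemLp X 2 π₁) (hX₂ : MemLp X 2 π₂) (hY₁ : MemLp Y 2 π₁) (hY₂ : MemLp Y 2 π₂) :
    ∫ q : Ω × Ω, (X q.1 - X q.2) * (Y q.1 - Y q.2) ∂(π₁.prod π₂) =
      ∫ ω, X ω * Y ω ∂π₁ - (∫ ω, X ω ∂π₁) * (∫ ω, Y ω ∂π₂)
        - (∫ ω, Y ω ∂π₁) * (∫ ω, X ω ∂π₂) + ∫ ω, X ω * Y ω ∂π₂ := by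
  have hX₁i := hX₁.integrable one_le_two
  have hX₂i := hX₂.integrable one_le_two
  have hY₁i := hY₁.integrable one_le_two
  have hY₂i := hY₂.integrable one_le_two
  have h₁ : Integrable (fun q : Ω × Ω => X q.1 * Y q.1) (π₁.prod π₂) :=
    (hX₁.integrable_mul hY₁).comp_fst π₂
  have h₂ : Integrable (fun q : Ω × Ω => X q.1 * Y q.2) (π₁.prod π₂) := hX₁i.mul_prod hY₂i
  have h₃ : Integrable (fun q : Ω × Ω => Y q.1 * X q.2) (π₁.prod π₂) := hY₁i.mul_prod hX₂i
  have h₄ : Integrable (fun q : Ω × Ω => X q.2 * Y q.2) (π₁.prod π₂) :=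
    (hX₂.integrable_mul hY₂).comp_snd π₁
  have hexp : (fun q : Ω × Ω => (X q.1 - X q.2) * (Y q.1 - Y q.2)) =
      fun q => X q.1 * Y q.1 - X q.1 * Y q.2 - Y q.1 * X q.2 + X q.2 * Y q.2 := by
    ext q; ring
  have h₁₂ : Integrable (fun q : Ω × Ω => X q.1 * Y q.1 - X q.1 * Y q.2) (π₁.prod π₂) := h₁.sub h₂
  have h₁₂₃ : Integrable (fun q : Ω × Ω => X q.1 * Y q.1 - X q.1 * Y q.2 - Y q.1 * X q.2)
      (π₁.prod π₂) := h₁₂.sub h₃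
  rw [hexp, integral_add h₁₂₃ h₄, integral_sub h₁₂ h₃, integral_sub h₁ h₂, integral_prod_mul, integral_prod_mul,
    integral_fun_fst (fun ω => X ω * Y ω), integral_fun_snd (fun ω => X ω * Y ω)]
  simp

/-- A centred random variable independent of `X` stays uncorrelated with functions of `X`
after conditioning on an event of `σ(X)`. -/
theorem ProbabilityTheory.IndepFun.integral_comp_mul_cond_eq_zero {Ω : Type*} [MeasurableSpace Ω]
    {μ : Measure Ω} {X Z : Ω → ℝ} (hind : IndepFun X Z μ) (hX : Measurable X) (hZ : Measurable Z)
    (hZ₀ : ∫ ω, Z ω ∂μ = 0) {g : ℝ → ℝ} (hg : Measurable g) {A : Set Ω}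
    (hA : MeasurableSet[MeasurableSpace.comap X inferInstance] A) :
    ∫ ω, g (X ω) * Z ω ∂(μ[|A]) = 0 := by
  obtain ⟨S, hS, rfl⟩ := hA
  have h : ∫ ω in X ⁻¹' S, g (X ω) * Z ω ∂μ = 0 := by
    have hgS : Measurable (S.indicator g) := hg.indicator hS
    have hprod := (hind.comp hgS measurable_id).integral_fun_mul_eq_mul_integral
      (hgS.comp hX).aestronglyMeasurable hZ.aestronglyMeasurable
    rw [← integral_indicator (hX hS)]
    simp only [Function.comp_apply, id] at hprod
    rw [hZ₀, mul_zero] at hprod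
    rw [← hprod]
    congr 1 with ω
    by_cases hω : X ω ∈ S <;> simp [Set.indicator, hω]
  simp [ProbabilityTheory.cond, h]

theorem MeasureTheory.MemLp.cond {Ω : Type*} [MeasurableSpace Ω] {μ : Measure Ω} {f : Ω → ℝ}
    {p : ENNReal} (hf : MemLp f p μ) {A : Set Ω} (hA : μ A ≠ 0) : MemLp f p (μ[|A]) :=
  (hf.restrict A).smul_measure (ENNReal.inv_ne_top.2 hA)

/-- If `Y - c X` is centred and independent of `X`, then for conditioning events in `σ(X)` the weak
comonotonicity integral of `X` and `Y` is `c` times that of `X` with itself. -/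
theorem integral_prod_cond_sub_mul_sub_eq {Ω : Type*} [MeasurableSpace Ω]
    {μ : Measure Ω} [IsProbabilityMeasure μ] {X Y : Ω → ℝ} (hX : Measurable X) (hY : Measurable Y)
    {c : ℝ} (hX₂ : MemLp X 2 μ) (hY₂ : MemLp Y 2 μ)
    (hind : IndepFun X (fun ω => Y ω - c * X ω) μ) (hZ₀ : ∫ ω, (Y ω - c * X ω) ∂μ = 0)
    {A B : Set Ω} (hA : MeasurableSet[MeasurableSpace.comap X inferInstance] A)
    (hB : MeasurableSet[MeasurableSpace.comap X inferInstance] B)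
    (hA₀ : μ A ≠ 0) (hB₀ : μ B ≠ 0) :
    ∫ q : Ω × Ω, (X q.1 - X q.2) * (Y q.1 - Y q.2) ∂((μ[|A]).prod (μ[|B])) =
      c * ∫ q : Ω × Ω, (X q.1 - X q.2) * (X q.1 - X q.2) ∂((μ[|A]).prod (μ[|B])) := by
  have := cond_isProbabilityMeasure hA₀
  have := cond_isProbabilityMeasure hB₀
  have hZ : Measurable fun ω => Y ω - c * X ω := hY.sub (hX.const_mul c)
  have mean : ∀ C, MeasurableSet[MeasurableSpace.comap X inferInstance] C → μ C ≠ 0 →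
      ∫ ω, Y ω ∂(μ[|C]) = c * ∫ ω, X ω ∂(μ[|C]) := fun C hC hC₀ => by
    have := cond_isProbabilityMeasure hC₀
    have h := hind.integral_comp_mul_cond_eq_zero hX hZ hZ₀ (measurable_const (a := (1 : ℝ))) hC
    simp only [one_mul] at h
    rw [integral_sub ((hY₂.cond hC₀).integrable one_le_two)
      (((hX₂.cond hC₀).integrable one_le_two).const_mul c), integral_const_mul] at h
    linarith
  have moment : ∀ C, MeasurableSet[MeasurableSpace.comap X inferInstance] C → μ C ≠ 0 →
      ∫ ω, X ω * Y ω ∂(μ[|C]) = c * ∫ ω, X ω * X ω ∂(μ[|C]) := fun C hC hC₀ => by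
    have h := hind.integral_comp_mul_cond_eq_zero hX hZ hZ₀ measurable_id hC
    have hXY : Integrable (fun ω => X ω * Y ω) (μ[|C]) :=
      (hX₂.cond hC₀).integrable_mul (hY₂.cond hC₀)
    have hXX : Integrable (fun ω => X ω * X ω) (μ[|C]) :=
      (hX₂.cond hC₀).integrable_mul (hX₂.cond hC₀)
    simp only [id, mul_sub, mul_left_comm _ c] at h
    rw [integral_sub hXY (hXX.const_mul c), integral_const_mul] at h
    linarith
  rw [integral_prod_sub_mul_sub _ _ (hX₂.cond hA₀) (hX₂.cond hB₀) (hY₂.cond hA₀) (hY₂.cond hB₀),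
    integral_prod_sub_mul_sub _ _ (hX₂.cond hA₀) (hX₂.cond hB₀) (hX₂.cond hA₀) (hX₂.cond hB₀),
    mean A hA hA₀, mean B hB hB₀, moment A hA hA₀, moment B hB hB₀]
  ring

/-- Proposition 4.3 (Wang–Zitikis, "Weak comonotonicity"). For `(X, Y)` jointly Gaussian
with standard normal margins and correlation `c ∈ [−1,1]`, the following are equivalent:
(i) `c ≥ 0`; (ii) `{ℙ_A × ℙ_B : A, B ∈ σ⁺(X)} ⊆ 𝒫_{X,Y}`;
(iii) `{ℙ_A × ℙ_A : A ∈ σ⁺(X)} ⊆ 𝒫_{X,Y}`. -/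
theorem gaussian_weaklyComonotonic_cond_iff {Ω : Type*} [MeasurableSpace Ω]
    (μ : Measure Ω) [IsProbabilityMeasure μ]
    (X Y : Ω → ℝ) (hX : Measurable X) (hY : Measurable Y)
    (c : ℝ) (hc : c ∈ Set.Icc (-1 : ℝ) 1)
    (hGauss : μ.map (fun ω => (X ω, Y ω)) =
      ((gaussianReal 0 1).prod (gaussianReal 0 1)).map
        (fun q : ℝ × ℝ => (q.1, c * q.1 + Real.sqrt (1 - c ^ 2) * q.2))) :
    ((0 ≤ c) ↔
      (∀ A B : Set Ω, MeasurableSet[MeasurableSpace.comap X inferInstance] A →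
        MeasurableSet[MeasurableSpace.comap X inferInstance] B →
        0 < μ A → 0 < μ B → WeaklyComonotonic X Y (μ[|A]) (μ[|B]))) ∧
    ((0 ≤ c) ↔
      (∀ A : Set Ω, MeasurableSet[MeasurableSpace.comap X inferInstance] A →
        0 < μ A → WeaklyComonotonic X Y (μ[|A]) (μ[|A]))) := by
  set γ : Measure ℝ := gaussianReal 0 1
  set s := Real.sqrt (1 - c ^ 2)
  have hXlaw : μ.map X = γ := by
    have h := congrArg (Measure.map Prod.fst) hGauss
    rw [Measure.map_map measurable_fst (by fun_prop),
      Measure.map_map measurable_fst (by fun_prop)] at h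
    exact h.trans (measurePreserving_fst (μ := γ) (ν := γ)).map_eq
  have hXZlaw : μ.map (fun ω => (X ω, Y ω - c * X ω)) = γ.prod (γ.map (s * ·)) := by
    have h := congrArg (Measure.map fun q : ℝ × ℝ => (q.1, q.2 - c * q.1)) hGauss
    rw [Measure.map_map (by fun_prop) (by fun_prop),
      Measure.map_map (by fun_prop) (by fun_prop)] at h
    refine h.trans ?_
    have hprod := Measure.map_prod_map γ γ measurable_id (measurable_const_mul s)
    rw [Measure.map_id] at hprod
    rw [hprod]
    congr 1 with q <;> simp
  have hZ : Measurable fun ω => Y ω - c * X ω := by fun_prop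
  have hZlaw : μ.map (fun ω => Y ω - c * X ω) = γ.map (s * ·) := by
    have h := congrArg (Measure.map Prod.snd) hXZlaw
    rw [Measure.map_map measurable_snd (by fun_prop)] at h
    have : IsProbabilityMeasure (γ.map (s * ·)) :=
      Measure.isProbabilityMeasure_map (by fun_prop)
    exact h.trans (measurePreserving_snd (μ := γ) (ν := γ.map (s * ·))).map_eq
  have hind : IndepFun X (fun ω => Y ω - c * X ω) μ := by
    rw [indepFun_iff_map_prod_eq_prod_map_map hX.aemeasurable hZ.aemeasurable, hXZlaw, hXlaw,
      hZlaw]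
  have hid : MemLp id 2 γ := memLp_id_gaussianReal 2
  have hX₂ : MemLp X 2 μ :=
    (memLp_map_measure_iff (g := id) (by fun_prop) hX.aemeasurable).1 (hXlaw ▸ hid)
  have hZ₂ : MemLp (fun ω => Y ω - c * X ω) 2 μ := by
    refine (memLp_map_measure_iff (g := id) (by fun_prop) hZ.aemeasurable).1 ?_
    rw [hZlaw, memLp_map_measure_iff (by fun_prop) (by fun_prop)]
    exact hid.const_mul s
  have hY₂ : MemLp Y 2 μ := by
    convert hZ₂.add (hX₂.const_mul c) using 1
    ext ω; simp
  have hX₀ : ∫ ω, X ω ∂μ = 0 := by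
    rw [← integral_map (f := fun x => x) hX.aemeasurable (by fun_prop), hXlaw]
    exact integral_id_gaussianReal
  have hZ₀ : ∫ ω, (Y ω - c * X ω) ∂μ = 0 := by
    rw [← integral_map (f := fun x => x) hZ.aemeasurable (by fun_prop), hZlaw,
      integral_map (by fun_prop) (by fun_prop), integral_const_mul]
    simp [γ, integral_id_gaussianReal]
  have hXX : ∫ ω, X ω * X ω ∂μ = 1 := by
    have h := variance_of_integral_eq_zero hX.aemeasurable hX₀
    rw [← variance_id_map hX.aemeasurable, hXlaw, variance_id_gaussianReal] at h
    simpa [sq] using h.symm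
  have key := fun A B hA hB hA₀ hB₀ =>
    integral_prod_cond_sub_mul_sub_eq (A := A) (B := B) hX hY hX₂ hY₂ hind hZ₀ hA hB hA₀ hB₀
  have of_nonneg : 0 ≤ c → ∀ A B : Set Ω,
      MeasurableSet[MeasurableSpace.comap X inferInstance] A →
      MeasurableSet[MeasurableSpace.comap X inferInstance] B →
      0 < μ A → 0 < μ B → WeaklyComonotonic X Y (μ[|A]) (μ[|B]) := fun hc₀ A B hA hB hA₀ hB₀ => by
    rw [WeaklyComonotonic, key A B hA hB hA₀.ne' hB₀.ne']
    exact mul_nonneg hc₀ (integral_nonneg fun q => mul_self_nonneg _)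
  have nonneg_of : (∀ A : Set Ω, MeasurableSet[MeasurableSpace.comap X inferInstance] A →
      0 < μ A → WeaklyComonotonic X Y (μ[|A]) (μ[|A])) → 0 ≤ c := fun h => by
    have h₀ := h Set.univ MeasurableSet.univ (by simp)
    rw [WeaklyComonotonic, key _ _ MeasurableSet.univ MeasurableSet.univ (by simp) (by simp),
      cond_univ, integral_prod_sub_mul_sub _ _ hX₂ hX₂ hX₂ hX₂, hX₀, hXX] at h₀
    linarith
  exact ⟨⟨of_nonneg, fun h => nonneg_of fun A hA hA₀ => h A A hA hA hA₀ hA₀⟩,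
    ⟨fun hc₀ A hA hA₀ => of_nonneg hc₀ A A hA hA hA₀ hA₀, nonneg_of⟩⟩
end

section
/- Let X and Y be random variables on a probability space (Ω, F, ℙ) with the relevant conditional expectations finite. If {ℙ_A × ℙ_B : A, B ∈ σ⁺(X)} ⊆ P_{X,Y}, then for all A, B ∈ σ⁺(X), E[XY | A] + E[XY | B] − E[X | A]·E[Y | B] − E[Y | A]·E[X | B] ≥ 0; in particular, taking A = B, the conditional covariance Cov[X, Y | A] = E[XY | A] − E[X | A]·E[Y | A] is non-negative for every event A ∈ σ⁺(X). -/
open MeasureTheory Set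

open ProbabilityTheory

/-- Expansion of the weak comonotonicity integral over a product of probability measures. -/
theorem integral_prod_sub_mul_sub_s9 {Ω : Type*} [MeasurableSpace Ω] (P Q : Measure Ω)
    [IsProbabilityMeasure P] [IsProbabilityMeasure Q] {X Y : Ω → ℝ}
    (hXP : Integrable X P) (hYP : Integrable Y P) (hXYP : Integrable (fun ω => X ω * Y ω) P)
    (hXQ : Integrable X Q) (hYQ : Integrable Y Q) (hXYQ : Integrable (fun ω => X ω * Y ω) Q) :
    ∫ q : Ω × Ω, (X q.1 - X q.2) * (Y q.1 - Y q.2) ∂(P.prod Q) =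
      (∫ ω, X ω * Y ω ∂P) + (∫ ω, X ω * Y ω ∂Q)
        - (∫ ω, X ω ∂P) * (∫ ω, Y ω ∂Q) - (∫ ω, Y ω ∂P) * (∫ ω, X ω ∂Q) := by
  have h₁ : Integrable (fun q : Ω × Ω => X q.1 * Y q.1) (P.prod Q) := hXYP.comp_fst Q
  have h₂ : Integrable (fun q : Ω × Ω => X q.2 * Y q.2) (P.prod Q) := hXYQ.comp_snd P
  have h₃ : Integrable (fun q : Ω × Ω => X q.1 * Y q.2) (P.prod Q) := hXP.mul_prod hYQ
  have h₄ : Integrable (fun q : Ω × Ω => Y q.1 * X q.2) (P.prod Q) := hYP.mul_prod hXQ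
  have hexp : (fun q : Ω × Ω => (X q.1 - X q.2) * (Y q.1 - Y q.2)) =
      fun q => X q.1 * Y q.1 + X q.2 * Y q.2 - X q.1 * Y q.2 - Y q.1 * X q.2 := by
    funext q
    ring
  have h₁₂ : Integrable (fun q : Ω × Ω => X q.1 * Y q.1 + X q.2 * Y q.2) (P.prod Q) := h₁.add h₂
  have h₁₂₃ : Integrable (fun q : Ω × Ω => X q.1 * Y q.1 + X q.2 * Y q.2 - X q.1 * Y q.2)
      (P.prod Q) := h₁₂.sub h₃
  rw [hexp, integral_sub h₁₂₃ h₄, integral_sub h₁₂ h₃,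
    integral_add h₁ h₂, integral_prod_mul, integral_prod_mul,
    integral_fun_fst (fun ω => X ω * Y ω), integral_fun_snd (fun ω => X ω * Y ω)]
  simp

/-- Proposition 4.4(ii) (Wang–Zitikis, "Weak comonotonicity"). If `X` and `Y` are weakly
comonotonic with respect to every `ℙ_A × ℙ_B` with `A, B ∈ σ⁺(X)`, then
`E[XY | A] + E[XY | B] − E[X | A]·E[Y | B] − E[Y | A]·E[X | B] ≥ 0` for all
`A, B ∈ σ⁺(X)`; in particular (taking `A = B`) the conditional covariance
`Cov[X, Y | A]` is non-negative for every `A ∈ σ⁺(X)`. -/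
theorem weaklyComonotonic_cond_implies_cond_cov_nonneg {Ω : Type*} [MeasurableSpace Ω]
    (μ : Measure Ω) [IsProbabilityMeasure μ]
    (X Y : Ω → ℝ) (hX : Measurable X) (hY : Measurable Y)
    (hInt : ∀ A : Set Ω, MeasurableSet A → 0 < μ A →
      Integrable X (μ[|A]) ∧ Integrable Y (μ[|A]) ∧
        Integrable (fun ω => X ω * Y ω) (μ[|A]))
    (hWC : ∀ A B : Set Ω, MeasurableSet[MeasurableSpace.comap X inferInstance] A →
      MeasurableSet[MeasurableSpace.comap X inferInstance] B →
      0 < μ A → 0 < μ B → WeaklyComonotonic X Y (μ[|A]) (μ[|B])) :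
    (∀ A B : Set Ω, MeasurableSet[MeasurableSpace.comap X inferInstance] A →
      MeasurableSet[MeasurableSpace.comap X inferInstance] B →
      0 < μ A → 0 < μ B →
      0 ≤ (∫ ω, X ω * Y ω ∂(μ[|A])) + (∫ ω, X ω * Y ω ∂(μ[|B]))
        - (∫ ω, X ω ∂(μ[|A])) * (∫ ω, Y ω ∂(μ[|B]))
        - (∫ ω, Y ω ∂(μ[|A])) * (∫ ω, X ω ∂(μ[|B]))) ∧
    (∀ A : Set Ω, MeasurableSet[MeasurableSpace.comap X inferInstance] A → 0 < μ A →
      0 ≤ (∫ ω, X ω * Y ω ∂(μ[|A]))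
        - (∫ ω, X ω ∂(μ[|A])) * (∫ ω, Y ω ∂(μ[|A]))) := by
  have hmain : ∀ A B : Set Ω, MeasurableSet[MeasurableSpace.comap X inferInstance] A →
      MeasurableSet[MeasurableSpace.comap X inferInstance] B →
      0 < μ A → 0 < μ B →
      0 ≤ (∫ ω, X ω * Y ω ∂(μ[|A])) + (∫ ω, X ω * Y ω ∂(μ[|B]))
        - (∫ ω, X ω ∂(μ[|A])) * (∫ ω, Y ω ∂(μ[|B]))
        - (∫ ω, Y ω ∂(μ[|A])) * (∫ ω, X ω ∂(μ[|B])) := by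
    intro A B hA hB hμA hμB
    obtain ⟨hXA, hYA, hXYA⟩ := hInt A (hX.comap_le A hA) hμA
    obtain ⟨hXB, hYB, hXYB⟩ := hInt B (hX.comap_le B hB) hμB
    have := cond_isProbabilityMeasure hμA.ne'
    have := cond_isProbabilityMeasure hμB.ne'
    rw [← integral_prod_sub_mul_sub_s9 _ _ hXA hYA hXYA hXB hYB hXYB]
    exact hWC A B hA hB hμA hμB
  refine ⟨hmain, fun A hA hμA => ?_⟩
  linarith [hmain A A hA hA hμA hμA]
end

section
/- Two random variables X and Y on a probability space (Ω, F, ℙ) are independent if and only if, for all Borel sets A, B ⊆ ℝ, the indicator random variables 1_{{X ∈ A}} and 1_{{Y ∈ B}} are weakly comonotonic with respect to ℙ × ℙ (equivalently, ℙ(X ∈ A, Y ∈ B) ≥ ℙ(X ∈ A)·ℙ(Y ∈ B) for all Borel A, B). The same characterization of independence holds with weak comonotonicity replaced by weak antimonotonicity. -/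
open MeasureTheory Set

open ProbabilityTheory

/-- The double integral defining weak comonotonicity is twice the covariance. -/
theorem integral_prod_sub_mul_sub_eq_two_mul_covariance {Ω : Type*} [MeasurableSpace Ω]
    {μ : Measure Ω} [IsProbabilityMeasure μ] {U V : Ω → ℝ} (hU : MemLp U 2 μ) (hV : MemLp V 2 μ) :
    ∫ q : Ω × Ω, (U q.1 - U q.2) * (V q.1 - V q.2) ∂(μ.prod μ) = 2 * cov[U, V; μ] := by
  have hUi : Integrable U μ := hU.integrable one_le_two
  have hVi : Integrable V μ := hV.integrable one_le_two
  have hUV : Integrable (fun ω => U ω * V ω) μ := hU.integrable_mul hV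
  have h₁ : Integrable (fun q : Ω × Ω => U q.1 * V q.1) (μ.prod μ) := hUV.comp_fst μ
  have h₂ : Integrable (fun q : Ω × Ω => U q.2 * V q.2) (μ.prod μ) := hUV.comp_snd μ
  have h₃ : Integrable (fun q : Ω × Ω => U q.1 * V q.2) (μ.prod μ) := hUi.mul_prod hVi
  have h₄ : Integrable (fun q : Ω × Ω => V q.1 * U q.2) (μ.prod μ) := hVi.mul_prod hUi
  calc ∫ q : Ω × Ω, (U q.1 - U q.2) * (V q.1 - V q.2) ∂(μ.prod μ)
      = ∫ q : Ω × Ω, (U q.1 * V q.1 + U q.2 * V q.2) - (U q.1 * V q.2 + V q.1 * U q.2)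
          ∂(μ.prod μ) := by
        congr 1 with q
        ring
    _ = 2 * cov[U, V; μ] := by
        rw [integral_sub (by exact h₁.add h₂) (by exact h₃.add h₄), integral_add h₁ h₂, integral_add h₃ h₄,
          integral_prod_mul U V, integral_prod_mul V U,
          integral_fun_fst (fun ω => U ω * V ω), integral_fun_snd (fun ω => U ω * V ω),
          covariance_eq_sub hU hV]
        simp only [probReal_univ, one_smul, Pi.mul_apply]
        ring

theorem covariance_indicator_one {Ω : Type*} [MeasurableSpace Ω]
    {μ : Measure Ω} [IsProbabilityMeasure μ] {S T : Set Ω}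
    (hS : MeasurableSet S) (hT : MeasurableSet T) :
    cov[S.indicator (fun _ => (1 : ℝ)), T.indicator (fun _ => (1 : ℝ)); μ] =
      μ.real (S ∩ T) - μ.real S * μ.real T := by
  have h : S.indicator (fun _ => (1 : ℝ)) * T.indicator (fun _ => (1 : ℝ)) =
      (S ∩ T).indicator (fun _ => (1 : ℝ)) := by
    ext ω
    simp [Set.inter_indicator_mul (fun _ => (1 : ℝ)) (fun _ => (1 : ℝ)) ω |>.symm]
  rw [covariance_eq_sub (memLp_indicator_const 2 hS 1 (.inr (measure_ne_top μ S)))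
    (memLp_indicator_const 2 hT 1 (.inr (measure_ne_top μ T))), h,
    integral_indicator_const _ (hS.inter hT), integral_indicator_const _ hS,
    integral_indicator_const _ hT]
  simp

/-- Two random variables are independent iff the indicators of the events they generate are
pairwise uncorrelated. -/
theorem indepFun_iff_integral_prod_indicator_eq_zero {Ω : Type*} [MeasurableSpace Ω]
    {μ : Measure Ω} [IsProbabilityMeasure μ] {X Y : Ω → ℝ} (hX : Measurable X)
    (hY : Measurable Y) :
    IndepFun X Y μ ↔ ∀ A B : Set ℝ, MeasurableSet A → MeasurableSet B →
      ∫ q : Ω × Ω, (A.indicator (fun _ => (1 : ℝ)) (X q.1) - A.indicator (fun _ => (1 : ℝ)) (X q.2))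
        * (B.indicator (fun _ => (1 : ℝ)) (Y q.1) - B.indicator (fun _ => (1 : ℝ)) (Y q.2))
        ∂(μ.prod μ) = 0 := by
  rw [indepFun_iff_measure_inter_preimage_eq_mul]
  refine forall₄_congr fun A B hA hB => ?_
  have h := integral_prod_sub_mul_sub_eq_two_mul_covariance
    (memLp_indicator_const 2 (hX hA) (1 : ℝ) (.inr (measure_ne_top μ _)))
    (memLp_indicator_const 2 (hY hB) (1 : ℝ) (.inr (measure_ne_top μ _)))
  rw [covariance_indicator_one (hX hA) (hY hB)] at h
  refine Iff.trans ?_ (Eq.congr_left h).symm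
  rw [mul_eq_zero_iff_left two_ne_zero, sub_eq_zero, measureReal_def, measureReal_def,
    measureReal_def, ← ENNReal.toReal_mul, ENNReal.toReal_eq_toReal_iff' (measure_ne_top μ _)
    (ENNReal.mul_ne_top (measure_ne_top μ _) (measure_ne_top μ _))]

/-- Replacing `A` by its complement flips the sign of the double integral. -/
theorem integral_prod_indicator_compl {Ω : Type*} [MeasurableSpace Ω]
    (π : Measure (Ω × Ω)) (X V : Ω → ℝ) (A : Set ℝ) :
    ∫ q : Ω × Ω, (Aᶜ.indicator (fun _ => (1 : ℝ)) (X q.1) -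
        Aᶜ.indicator (fun _ => (1 : ℝ)) (X q.2)) * (V q.1 - V q.2) ∂π =
      -∫ q : Ω × Ω, (A.indicator (fun _ => (1 : ℝ)) (X q.1) -
        A.indicator (fun _ => (1 : ℝ)) (X q.2)) * (V q.1 - V q.2) ∂π := by
  rw [← integral_neg]
  congr 1 with q
  simp only [Set.indicator_compl, Pi.sub_apply]
  ring

/-- Statement (S4) (Wang–Zitikis, "Weak comonotonicity"). `X` and `Y` are independent if
and only if, for all Borel sets `A, B ⊆ ℝ`, the indicators `1_{X ∈ A}` and `1_{Y ∈ B}` are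
weakly comonotonic with respect to `ℙ × ℙ`; the same holds with weak comonotonicity
replaced by weak antimonotonicity. -/
theorem indepFun_iff_indicator_weaklyComonotonic {Ω : Type*} [MeasurableSpace Ω]
    (μ : Measure Ω) [IsProbabilityMeasure μ]
    (X Y : Ω → ℝ) (hX : Measurable X) (hY : Measurable Y) :
    (IndepFun X Y μ ↔
      ∀ A B : Set ℝ, MeasurableSet A → MeasurableSet B →
        WeaklyComonotonic (fun ω => A.indicator (fun _ => (1 : ℝ)) (X ω))
          (fun ω => B.indicator (fun _ => (1 : ℝ)) (Y ω)) μ μ) ∧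
    (IndepFun X Y μ ↔
      ∀ A B : Set ℝ, MeasurableSet A → MeasurableSet B →
        WeaklyAntimonotonic (fun ω => A.indicator (fun _ => (1 : ℝ)) (X ω))
          (fun ω => B.indicator (fun _ => (1 : ℝ)) (Y ω)) μ μ) := by
  rw [indepFun_iff_integral_prod_indicator_eq_zero hX hY]
  refine ⟨⟨fun h A B hA hB => (h A B hA hB).ge, fun h A B hA hB => ?_⟩,
    ⟨fun h A B hA hB => (h A B hA hB).le, fun h A B hA hB => ?_⟩⟩
  · have hc := h Aᶜ B hA.compl hB
    rw [WeaklyComonotonic, integral_prod_indicator_compl _ X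
      (fun ω => B.indicator (fun _ => (1 : ℝ)) (Y ω))] at hc
    exact le_antisymm (neg_nonneg.mp hc) (h A B hA hB)
  · have hc := h Aᶜ B hA.compl hB
    rw [WeaklyAntimonotonic, integral_prod_indicator_compl _ X
      (fun ω => B.indicator (fun _ => (1 : ℝ)) (Y ω))] at hc
    exact le_antisymm (h A B hA hB) (neg_nonpos.mp hc)
end

section
/- Let X and Y be random variables on a probability space (Ω, F, ℙ). The following two statements are equivalent: (i) for all non-decreasing Borel functions g and h, the functions g and h*, where h*(x) := E[h(Y) | X = x], are weakly comonotonic with respect to all product measures ρ₁ × ρ₂ on ℝ² (equivalently, g and h* are strongly comonotonic for all non-decreasing Borel g, h); (ii) Y is positively regression dependent on X, i.e., for every y ∈ ℝ, the map x ↦ F_{Y|X}(y | x) = ℙ(Y ≤ y | X = x) is non-increasing. -/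
open MeasureTheory Set

open ProbabilityTheory

/-- If `ν` dominates `μ` on every `Iic a`, then it does so on every lower set of `ℝ`. -/
theorem IsLowerSet.measure_le_of_forall_Iic {μ ν : Measure ℝ} (H : ∀ a, μ (Iic a) ≤ ν (Iic a))
    {L : Set ℝ} (hL : IsLowerSet L) : μ L ≤ ν L := by
  by_cases hmax : ∃ a, IsGreatest L a
  · obtain ⟨a, ha, hub⟩ := hmax
    have : L = Iic a := Set.Subset.antisymm (fun x hx => hub hx) fun x hx => hL hx ha
    rw [this]
    exact H a
  · have hL' : L = ⋃ q ∈ {q : ℚ | (q : ℝ) ∈ L}, Iic (q : ℝ) := by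
      ext x
      simp only [mem_iUnion, mem_ofPred_eq, mem_Iic, exists_prop]
      refine ⟨fun hx => ?_, fun ⟨q, hq, hxq⟩ => hL hxq hq⟩
      obtain ⟨z, hz, hxz⟩ : ∃ z ∈ L, x < z := by
        by_contra! h
        exact hmax ⟨x, hx, h⟩
      obtain ⟨q, hxq, hqz⟩ := exists_rat_btwn hxz
      exact ⟨q, hL hqz.le hz, hxq.le⟩
    have hdir : DirectedOn (Function.onFun (· ⊆ ·) fun q : ℚ => Iic (q : ℝ)) {q : ℚ | (q : ℝ) ∈ L} := by
      intro a ha b hb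
      refine ⟨max a b, ?_, ?_, ?_⟩
      · rcases max_choice a b with h | h <;> rw [h] <;> assumption
      · exact Iic_subset_Iic.2 (by exact_mod_cast le_max_left a b)
      · exact Iic_subset_Iic.2 (by exact_mod_cast le_max_right a b)
    rw [hL', measure_biUnion_eq_iSup (to_countable _) hdir,
      measure_biUnion_eq_iSup (to_countable _) hdir]
    exact iSup₂_mono fun q _ => H q

/-- Stochastic dominance on upper sets. -/
theorem IsUpperSet.measure_le_of_forall_Iic {μ ν : Measure ℝ} [IsProbabilityMeasure μ]
    [IsProbabilityMeasure ν] (H : ∀ a, μ (Iic a) ≤ ν (Iic a))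
    {U : Set ℝ} (hU : IsUpperSet U) : ν U ≤ μ U := by
  have hm : MeasurableSet U := hU.ordConnected.measurableSet
  have h := hU.compl.measure_le_of_forall_Iic H
  rw [prob_compl_eq_one_sub hm, prob_compl_eq_one_sub hm] at h
  exact (ENNReal.sub_le_sub_iff_left prob_le_one ENNReal.one_ne_top).1 h

/-- If every super-level set `{t < f}` is smaller for `μ` than for `ν`, so is the integral of the
positive part of `f`. -/
theorem lintegral_ofReal_le_of_forall_meas_lt {μ ν : Measure ℝ} {f : ℝ → ℝ} (hf : Measurable f)
    (H : ∀ t, μ {x | t < f x} ≤ ν {x | t < f x}) :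
    ∫⁻ x, ENNReal.ofReal (f x) ∂μ ≤ ∫⁻ x, ENNReal.ofReal (f x) ∂ν := by
  have key : ∀ ρ : Measure ℝ,
      ∫⁻ x, ENNReal.ofReal (f x) ∂ρ = ∫⁻ t in Ioi (0 : ℝ), ρ {x | t < f x} := by
    intro ρ
    have h := lintegral_eq_lintegral_meas_lt ρ (f := fun x => max (f x) 0)
      (Filter.Eventually.of_forall fun x => le_max_right _ _)
      (hf.max measurable_const).aemeasurable
    simp only [ENNReal.ofReal_max, ENNReal.ofReal_zero, zero_le, max_eq_left] at h
    rw [h]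
    refine setLIntegral_congr_fun measurableSet_Ioi fun t ht => ?_
    have ht' : ¬ t < 0 := not_lt.2 (le_of_lt ht)
    simp [ht']
  rw [key, key]
  exact lintegral_mono fun t => H t

/-- First-order stochastic dominance compares the integrals of monotone functions. -/
theorem Monotone.integral_le_of_forall_Iic {μ ν : Measure ℝ} [IsProbabilityMeasure μ]
    [IsProbabilityMeasure ν] (H : ∀ a, μ (Iic a) ≤ ν (Iic a)) {h : ℝ → ℝ} (hh : Monotone h)
    (hμ : Integrable h μ) (hν : Integrable h ν) : ∫ y, h y ∂ν ≤ ∫ y, h y ∂μ := by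
  have hpos : ∫⁻ y, ENNReal.ofReal (h y) ∂ν ≤ ∫⁻ y, ENNReal.ofReal (h y) ∂μ :=
    lintegral_ofReal_le_of_forall_meas_lt hh.measurable fun t =>
      IsUpperSet.measure_le_of_forall_Iic H fun _ _ hab ha => lt_of_lt_of_le ha (hh hab)
  have hneg : ∫⁻ y, ENNReal.ofReal (-h y) ∂μ ≤ ∫⁻ y, ENNReal.ofReal (-h y) ∂ν :=
    lintegral_ofReal_le_of_forall_meas_lt hh.measurable.neg fun t =>
      IsLowerSet.measure_le_of_forall_Iic H fun _ _ hab ha =>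
        lt_of_lt_of_le ha (neg_le_neg (hh hab))
  rw [integral_eq_lintegral_pos_part_sub_lintegral_neg_part hμ,
    integral_eq_lintegral_pos_part_sub_lintegral_neg_part hν]
  have h₁ := ENNReal.toReal_mono hμ.lintegral_lt_top.ne hpos
  have h₂ := ENNReal.toReal_mono hν.neg.lintegral_lt_top.ne hneg
  exact sub_le_sub h₁ h₂

/-- Proposition 4.6 (Wang–Zitikis, "Weak comonotonicity"). The following are equivalent:
(i) for all non-decreasing Borel `g, h`, the functions `g` and `h*` (with
`h*(x) = E[h(Y) | X = x]` computed from the conditional distribution of `Y` given `X`)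
are weakly comonotonic with respect to all product measures, equivalently strongly
comonotonic; (ii) `Y` is positively regression dependent on `X`, i.e., for every `y`,
`x ↦ F_{Y|X}(y | x)` is non-increasing. -/
theorem regression_stronglyComonotonic_iff_positiveRegressionDependent
    {Ω : Type*} [MeasurableSpace Ω] (μ : Measure Ω) [IsProbabilityMeasure μ]
    (X Y : Ω → ℝ) (hX : Measurable X) (hY : Measurable Y) :
    (∀ g h : ℝ → ℝ, Monotone g → Monotone h → Measurable g → Measurable h →
      (∀ x : ℝ, Integrable h (condDistrib Y X μ x)) →
      ∀ x x' : ℝ,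
        0 ≤ (g x - g x') *
          ((∫ y, h y ∂(condDistrib Y X μ x)) - (∫ y, h y ∂(condDistrib Y X μ x')))) ↔
    (∀ y : ℝ, Antitone (fun x : ℝ => ((condDistrib Y X μ x) (Set.Iic y)).toReal)) := by
  constructor
  · intro H y x x' hxx'
    rcases hxx'.eq_or_lt with rfl | hlt
    · exact le_rfl
    have hmono : Monotone ((Ioi y).indicator (1 : ℝ → ℝ)) := by
      intro a b hab
      by_cases ha : y < a
      · simp [ha, ha.trans_le hab]
      · rw [indicator_of_notMem (show a ∉ Ioi y from ha)]
        exact indicator_nonneg (fun _ _ => zero_le_one) b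
    have h := H id _ monotone_id hmono measurable_id hmono.measurable
      (fun x => (integrable_const (1 : ℝ)).indicator measurableSet_Ioi) x x'
    simp only [integral_indicator_one measurableSet_Ioi, id] at h
    have h' := nonpos_of_mul_nonneg_right h (sub_neg.2 hlt)
    have hcompl : ∀ z, (condDistrib Y X μ z).real (Ioi y)
        = 1 - (condDistrib Y X μ z).real (Iic y) := fun z => by
      rw [← compl_Iic, probReal_compl_eq_one_sub measurableSet_Iic]
    rw [hcompl, hcompl] at h'
    change (condDistrib Y X μ x').real (Iic y) ≤ (condDistrib Y X μ x).real (Iic y)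
    linarith
  · intro H g h hg hh _ _ hint
    have key : Monotone fun x => ∫ y, h y ∂(condDistrib Y X μ x) := fun x x' hxx' =>
      hh.integral_le_of_forall_Iic
        (fun a => (ENNReal.toReal_le_toReal (measure_ne_top _ _) (measure_ne_top _ _)).1
          (H a hxx')) (hint x') (hint x)
    intro x x'
    rcases le_total x x' with hx | hx
    · exact mul_nonneg_of_nonpos_of_nonpos (sub_nonpos.2 (hg hx)) (sub_nonpos.2 (key hx))
    · exact mul_nonneg (sub_nonneg.2 (hg hx)) (sub_nonneg.2 (key hx))
end

section
/- Let X be a continuously distributed random variable on an atomless probability space, let α₁, …, α_n > 0 with α₁ + … + α_n < 1, and let β ∈ [0,1]. Then V_β(X) = Q_γ(X), where γ = min(β, max(α₁, …, α_n)) + Σ_{i=1}^n (α_i − β)₊ and V_β(X) = inf{ Σ_{i=1}^n Q_{α_i}(X_i) : (X₁, …, X_n) ∈ 𝔸_n(X), X_i ↑_β X for i = 1, …, n }. -/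
open MeasureTheory Set

/-- Left quantile at level `α`: `Q_α(Y) = inf {x ∈ ℝ : ℙ(Y ≤ x) ≥ 1 − α}`. -/
noncomputable def Qleft {Ω : Type*} [MeasurableSpace Ω] (μ : Measure Ω) (Y : Ω → ℝ) (α : ℝ) : ℝ :=
  sInf {x : ℝ | 1 - α ≤ (μ {ω | Y ω ≤ x}).toReal}

/-- `Y ↑_β Z`: `Y` and `Z` are weakly comonotonic with respect to
`∪_{p ∈ [1−β, 1)} 𝒫^Z_p` (no constraint when `β = 0`). -/
def UpBeta {Ω : Type*} [MeasurableSpace Ω] (μ : Measure Ω) (Y Z : Ω → ℝ) (β : ℝ) : Prop :=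
  ∀ p ∈ Set.Ico (1 - β) 1, ∀ ω ∈ tailSet μ Z p, ∀ ω' ∉ tailSet μ Z p,
    WeaklyComonotonic Y Z (Measure.dirac ω) (Measure.dirac ω')

open ProbabilityTheory Filter Topology

section

variable {Ω : Type*} [MeasurableSpace Ω] {μ : Measure Ω}

theorem weaklyComonotonic_dirac {Y Z : Ω → ℝ} (hY : Measurable Y) (hZ : Measurable Z)
    (ω ω' : Ω) :
    WeaklyComonotonic Y Z (Measure.dirac ω) (Measure.dirac ω') ↔
      0 ≤ (Y ω - Y ω') * (Z ω - Z ω') := by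
  have hm : StronglyMeasurable fun q : Ω × Ω => (Y q.1 - Y q.2) * (Z q.1 - Z q.2) :=
    Measurable.stronglyMeasurable (by fun_prop)
  rw [WeaklyComonotonic, Measure.dirac_prod_dirac, integral_dirac' _ _ hm]

theorem upBeta_iff {Y Z : Ω → ℝ} (hY : Measurable Y) (hZ : Measurable Z) {β : ℝ} :
    UpBeta μ Y Z β ↔
      ∀ p ∈ Ico (1 - β) 1, ∀ ω ∈ tailSet μ Z p, ∀ ω' ∉ tailSet μ Z p, Y ω' ≤ Y ω := by
  unfold UpBeta
  refine forall₂_congr fun p _ => forall₂_congr fun ω hω => forall₂_congr fun ω' hω' => ?_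
  have hlt : Z ω' < Z ω := (not_lt.1 hω').trans_lt hω
  rw [weaklyComonotonic_dirac hY hZ, mul_nonneg_iff_of_pos_right (sub_pos.2 hlt), sub_nonneg]

theorem toReal_measure_le_eq_cdf [IsProbabilityMeasure μ] {Y : Ω → ℝ} (hY : Measurable Y) (x : ℝ) :
    (μ {ω | Y ω ≤ x}).toReal = cdf (μ.map Y) x := by
  have := Measure.isProbabilityMeasure_map (μ := μ) hY.aemeasurable
  rw [cdf_eq_real, map_measureReal_apply hY measurableSet_Iic]
  rfl

theorem bddBelow_le_cdf (ν : Measure ℝ) {u : ℝ} (hu : 0 < u) :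
    BddBelow {x : ℝ | u ≤ cdf ν x} := by
  obtain ⟨a, ha⟩ := ((tendsto_cdf_atBot ν).eventually (gt_mem_nhds hu)).exists
  refine ⟨a, fun x hx => ?_⟩
  by_contra! h
  exact (hx.trans (monotone_cdf ν h.le)).not_gt ha

theorem nonempty_lt_cdf (ν : Measure ℝ) {u : ℝ} (hu : u < 1) :
    {x : ℝ | u < cdf ν x}.Nonempty :=
  ((tendsto_cdf_atTop ν).eventually (lt_mem_nhds hu)).exists

theorem Qleft_le_of_le_measure [IsProbabilityMeasure μ] {Y : Ω → ℝ} (hY : Measurable Y)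
    {a x : ℝ} (ha : a < 1) (hx : 1 - a ≤ (μ {ω | Y ω ≤ x}).toReal) : Qleft μ Y a ≤ x := by
  refine csInf_le ?_ hx
  simp only [toReal_measure_le_eq_cdf hY]
  exact bddBelow_le_cdf _ (by linarith)

theorem le_measure_le_Qleft [IsProbabilityMeasure μ] {Y : Ω → ℝ} (hY : Measurable Y)
    {a : ℝ} (ha : 0 < a) : 1 - a ≤ (μ {ω | Y ω ≤ Qleft μ Y a}).toReal := by
  unfold Qleft
  simp only [toReal_measure_le_eq_cdf hY]
  set S := {x : ℝ | 1 - a ≤ cdf (μ.map Y) x}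
  have hne : S.Nonempty := by
    obtain ⟨x, hx⟩ := nonempty_lt_cdf (μ.map Y) (u := 1 - a) (by linarith)
    exact ⟨x, (show 1 - a < cdf (μ.map Y) x from hx).le⟩
  have hlim : Tendsto (cdf (μ.map Y)) (𝓝[>] (sInf S)) (𝓝 (cdf (μ.map Y) (sInf S))) :=
    ((cdf (μ.map Y)).right_continuous _).mono Ioi_subset_Ici_self
  refine ge_of_tendsto hlim (eventually_mem_nhdsWithin.mono fun x hx => ?_)
  obtain ⟨y, hy, hyx⟩ := exists_lt_of_csInf_lt hne hx
  exact le_trans hy (monotone_cdf _ hyx.le)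

theorem continuous_cdf_map [IsProbabilityMeasure μ] {X : Ω → ℝ} (hX : Measurable X)
    (hXc : ContinuouslyDistributed μ X) : Continuous (cdf (μ.map X)) := by
  have := Measure.isProbabilityMeasure_map (μ := μ) hX.aemeasurable
  refine continuous_iff_continuousAt.2 fun x => ?_
  rw [(monotone_cdf _).continuousAt_iff_leftLim_eq_rightLim, StieltjesFunction.rightLim_eq]
  refine le_antisymm ((monotone_cdf _).leftLim_le le_rfl) ?_
  have h : (μ.map X) {x} = 0 := by
    rw [Measure.map_apply hX (measurableSet_singleton x)]
    exact hXc x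
  rw [← measure_cdf (μ.map X), StieltjesFunction.measure_singleton, ENNReal.ofReal_eq_zero] at h
  linarith

theorem exists_cdf_eq {ν : Measure ℝ} (hc : Continuous (cdf ν)) {u : ℝ} (h0 : 0 < u)
    (h1 : u < 1) : ∃ x, cdf ν x = u :=
  mem_range_of_exists_le_of_exists_ge hc
    (((tendsto_cdf_atBot ν).eventually (gt_mem_nhds h0)).exists.imp fun _ h => le_of_lt h)
    (((tendsto_cdf_atTop ν).eventually (lt_mem_nhds h1)).exists.imp fun _ h => le_of_lt h)

theorem measurable_cdf_comp {X : Ω → ℝ} (hX : Measurable X) :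
    Measurable fun ω => cdf (μ.map X) (X ω) :=
  (monotone_cdf _).measurable.comp hX

theorem measureReal_cdf_comp_lt_le [IsProbabilityMeasure μ] {X : Ω → ℝ} (hX : Measurable X)
    (hXc : ContinuouslyDistributed μ X) {u : ℝ} (hu : u ∈ Icc (0 : ℝ) 1) :
    μ.real {ω | cdf (μ.map X) (X ω) < u} ≤ u := by
  rcases hu.1.eq_or_lt with rfl | h0
  · simp [(cdf_nonneg _ _).not_gt]
  rcases hu.2.eq_or_lt with rfl | h1
  · exact measureReal_le_one
  obtain ⟨x, hx⟩ := exists_cdf_eq (continuous_cdf_map hX hXc) h0 h1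
  conv_rhs => rw [← hx, ← toReal_measure_le_eq_cdf hX]
  refine measureReal_mono fun ω hω => ?_
  by_contra h
  exact (hx.symm.le.trans (monotone_cdf _ (not_le.1 h).le)).not_gt hω

theorem le_measureReal_cdf_comp_le [IsProbabilityMeasure μ] {X : Ω → ℝ} (hX : Measurable X)
    (hXc : ContinuouslyDistributed μ X) {u : ℝ} (hu : u ∈ Icc (0 : ℝ) 1) :
    u ≤ μ.real {ω | cdf (μ.map X) (X ω) ≤ u} := by
  rcases hu.1.eq_or_lt with rfl | h0
  · exact measureReal_nonneg
  rcases hu.2.eq_or_lt with rfl | h1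
  · simp [cdf_le_one]
  obtain ⟨x, hx⟩ := exists_cdf_eq (continuous_cdf_map hX hXc) h0 h1
  conv_lhs => rw [← hx, ← toReal_measure_le_eq_cdf hX]
  exact measureReal_mono fun ω hω => (monotone_cdf _ hω).trans hx.le

/-- Probability integral transform, for closed lower intervals. -/
theorem measureReal_cdf_comp_le [IsProbabilityMeasure μ] {X : Ω → ℝ} (hX : Measurable X)
    (hXc : ContinuouslyDistributed μ X) {u : ℝ} (hu : u ∈ Icc (0 : ℝ) 1) :
    μ.real {ω | cdf (μ.map X) (X ω) ≤ u} = u := by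
  refine le_antisymm (le_of_forall_gt_imp_ge_of_dense fun v hv => ?_)
    (le_measureReal_cdf_comp_le hX hXc hu)
  rcases le_total v 1 with h1 | h1
  · exact (measureReal_mono fun ω hω => lt_of_le_of_lt hω hv).trans
      (measureReal_cdf_comp_lt_le hX hXc ⟨hu.1.trans hv.le, h1⟩)
  · exact measureReal_le_one.trans h1

/-- Probability integral transform, for open lower intervals. -/
theorem measureReal_cdf_comp_lt [IsProbabilityMeasure μ] {X : Ω → ℝ} (hX : Measurable X)
    (hXc : ContinuouslyDistributed μ X) {u : ℝ} (hu : u ∈ Icc (0 : ℝ) 1) :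
    μ.real {ω | cdf (μ.map X) (X ω) < u} = u := by
  refine le_antisymm (measureReal_cdf_comp_lt_le hX hXc hu)
    (le_of_forall_lt_imp_le_of_dense fun v hv => ?_)
  rcases le_total 0 v with h0 | h0
  · exact (le_measureReal_cdf_comp_le hX hXc ⟨h0, hv.le.trans hu.2⟩).trans
      (measureReal_mono fun ω hω => lt_of_le_of_lt hω hv)
  · exact h0.trans measureReal_nonneg

theorem measureReal_lt_cdf_comp [IsProbabilityMeasure μ] {X : Ω → ℝ} (hX : Measurable X)
    (hXc : ContinuouslyDistributed μ X) {u : ℝ} (hu : u ∈ Icc (0 : ℝ) 1) :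
    μ.real {ω | u < cdf (μ.map X) (X ω)} = 1 - u := by
  have hm : MeasurableSet {ω | cdf (μ.map X) (X ω) ≤ u} :=
    measurable_cdf_comp hX measurableSet_Iic
  rw [← measureReal_cdf_comp_le hX hXc hu, ← probReal_compl_eq_one_sub hm,
    measureReal_cdf_comp_le hX hXc hu]
  congr 1
  ext ω
  simp

theorem measureReal_le_cdf_comp [IsProbabilityMeasure μ] {X : Ω → ℝ} (hX : Measurable X)
    (hXc : ContinuouslyDistributed μ X) {u : ℝ} (hu : u ∈ Icc (0 : ℝ) 1) :
    μ.real {ω | u ≤ cdf (μ.map X) (X ω)} = 1 - u := by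
  have hm : MeasurableSet {ω | cdf (μ.map X) (X ω) < u} :=
    measurable_cdf_comp hX measurableSet_Iio
  rw [← measureReal_cdf_comp_lt hX hXc hu, ← probReal_compl_eq_one_sub hm,
    measureReal_cdf_comp_lt hX hXc hu]
  congr 1
  ext ω
  simp

theorem measureReal_cdf_comp_mem_Ico [IsProbabilityMeasure μ] {X : Ω → ℝ} (hX : Measurable X)
    (hXc : ContinuouslyDistributed μ X) {u v : ℝ} (hu : 0 ≤ u) (huv : u ≤ v) (hv : v ≤ 1) :
    μ.real {ω | cdf (μ.map X) (X ω) ∈ Ico u v} = v - u := by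
  have hm : MeasurableSet {ω | cdf (μ.map X) (X ω) < u} :=
    measurable_cdf_comp hX measurableSet_Iio
  have hset : {ω | cdf (μ.map X) (X ω) ∈ Ico u v} =
      {ω | cdf (μ.map X) (X ω) < v} \ {ω | cdf (μ.map X) (X ω) < u} := by
    ext ω
    simp [and_comm]
  have hsub : {ω | cdf (μ.map X) (X ω) < u} ⊆ {ω | cdf (μ.map X) (X ω) < v} :=
    fun ω hω => lt_of_lt_of_le hω huv
  rw [hset, measureReal_sdiff hsub hm,
    measureReal_cdf_comp_lt hX hXc ⟨hu.trans huv, hv⟩,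
    measureReal_cdf_comp_lt hX hXc ⟨hu, huv.trans hv⟩]

theorem lt_cdf_of_mem_tailSet [IsProbabilityMeasure μ] {X : Ω → ℝ} (hX : Measurable X)
    {p : ℝ} (hp : p < 1) {ω : Ω} (hω : ω ∈ tailSet μ X p) : p < cdf (μ.map X) (X ω) := by
  simp only [tailSet, VaR, toReal_measure_le_eq_cdf hX, mem_ofPred_eq] at hω
  obtain ⟨y, hy, hyx⟩ := exists_lt_of_csInf_lt (nonempty_lt_cdf _ hp) hω
  exact lt_of_lt_of_le hy (monotone_cdf _ hyx.le)

theorem tailSet_eq [IsProbabilityMeasure μ] {X : Ω → ℝ} (hX : Measurable X)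
    (hXc : ContinuouslyDistributed μ X) {p : ℝ} (hp0 : 0 < p) (hp1 : p < 1) :
    tailSet μ X p = {ω | p < cdf (μ.map X) (X ω)} := by
  refine Subset.antisymm (fun ω => lt_cdf_of_mem_tailSet hX hp1) fun ω hω => ?_
  have hev : ∀ᶠ y in 𝓝[<] (X ω), p < cdf (μ.map X) y :=
    ((continuous_cdf_map hX hXc).continuousAt.eventually (lt_mem_nhds hω)).filter_mono
      nhdsWithin_le_nhds
  obtain ⟨y, hy, hyx⟩ := (hev.and eventually_mem_nhdsWithin).exists
  simp only [tailSet, VaR, toReal_measure_le_eq_cdf hX, mem_ofPred_eq]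
  have hbdd : BddBelow {x : ℝ | p < cdf (μ.map X) x} :=
    (bddBelow_le_cdf (μ.map X) hp0).mono fun x (hx : p < cdf (μ.map X) x) => hx.le
  exact lt_of_le_of_lt (csInf_le hbdd hy) hyx

theorem Qleft_sum_le [IsProbabilityMeasure μ] {X : Ω → ℝ} (hX : Measurable X)
    (hXc : ContinuouslyDistributed μ X) {ι : Type*} [Fintype ι] {α : ι → ℝ}
    (hα : ∀ i, 0 < α i) {β m : ℝ} (hm0 : 0 ≤ m) (hm1 : m < 1) (hmβ : m ≤ β)
    (hγ : m + ∑ i, max (α i - m) 0 < 1) {Xs : ι → Ω → ℝ} (hXs : ∀ i, Measurable (Xs i))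
    (hle : ∀ ω, X ω ≤ ∑ i, Xs i ω) (hup : ∀ i, UpBeta μ (Xs i) X β) :
    Qleft μ X (m + ∑ i, max (α i - m) 0) ≤ ∑ i, Qleft μ (Xs i) (α i) := by
  set A := {ω | 1 - m < cdf (μ.map X) (X ω)} with hAdef
  have hAm : MeasurableSet A := measurable_cdf_comp hX measurableSet_Ioi
  have hA : μ.real A = m := by
    rw [measureReal_lt_cdf_comp hX hXc ⟨by linarith, by linarith⟩]
    ring
  have hB : ∀ i, MeasurableSet {ω | Qleft μ (Xs i) (α i) < Xs i ω} := fun i =>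
    hXs i measurableSet_Ioi
  have htail : ∀ i, μ.real {ω | Qleft μ (Xs i) (α i) < Xs i ω} ≤ α i := fun i => by
    have h := le_measure_le_Qleft (μ := μ) (hXs i) (hα i)
    have hc := probReal_compl_eq_one_sub (μ := μ) (hB i)
    have he : {ω | Qleft μ (Xs i) (α i) < Xs i ω}ᶜ = {ω | Xs i ω ≤ Qleft μ (Xs i) (α i)} := by
      ext ω
      simp
    rw [he, measureReal_def] at hc
    linarith
  have hdiff : ∀ i, μ.real ({ω | Qleft μ (Xs i) (α i) < Xs i ω} \ A) ≤ max (α i - m) 0 := by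
    intro i
    rcases ({ω | Qleft μ (Xs i) (α i) < Xs i ω} \ A).eq_empty_or_nonempty with h | ⟨ω', hω', hA'⟩
    · simp [h]
    have hsub : A ⊆ {ω | Qleft μ (Xs i) (α i) < Xs i ω} := by
      intro ω hω
      have hmpos : 0 < m := by
        have h1 := cdf_le_one (μ.map X) (X ω)
        have h2 : 1 - m < cdf (μ.map X) (X ω) := hω
        linarith
      rw [hAdef, ← tailSet_eq hX hXc (by linarith) (by linarith)] at hω hA'
      exact lt_of_lt_of_le hω' ((upBeta_iff (hXs i) hX).1 (hup i) (1 - m)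
        ⟨by linarith, by linarith⟩ ω hω ω' hA')
    rw [measureReal_sdiff hsub hAm, hA]
    exact (sub_le_sub_right (htail i) m).trans (le_max_left _ _)
  have hcover : {ω | X ω ≤ ∑ i, Qleft μ (Xs i) (α i)}ᶜ ⊆
      A ∪ ⋃ i, {ω | Qleft μ (Xs i) (α i) < Xs i ω} \ A := by
    intro ω hω
    by_cases hωA : ω ∈ A
    · exact Or.inl hωA
    refine Or.inr (mem_iUnion.2 ?_)
    by_contra! h
    refine hω ((hle ω).trans (Finset.sum_le_sum fun i _ => ?_))
    by_contra! hi
    exact h i ⟨hi, hωA⟩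
  have hmeas : MeasurableSet {ω | X ω ≤ ∑ i, Qleft μ (Xs i) (α i)} := hX measurableSet_Iic
  have hbound : μ.real {ω | X ω ≤ ∑ i, Qleft μ (Xs i) (α i)}ᶜ ≤ m + ∑ i, max (α i - m) 0 := by
    refine (measureReal_mono hcover).trans ((measureReal_union_le _ _).trans ?_)
    refine add_le_add hA.le ((measureReal_iUnion_fintype_le _).trans ?_)
    exact Finset.sum_le_sum fun i _ => hdiff i
  refine Qleft_le_of_le_measure hX hγ ?_
  rw [probReal_compl_eq_one_sub hmeas] at hbound
  rw [← measureReal_def]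
  linarith

/-- An allocation of `X` that pays the excess of `X` over `q` to agent `i` on the event `S i`. -/
theorem exists_allocation [IsProbabilityMeasure μ] {X : Ω → ℝ} (hX : Measurable X)
    {ι : Type*} [Fintype ι] [Nonempty ι] {α : ι → ℝ} (hα : ∀ i, α i < 1) {β q : ℝ}
    {S : ι → Set Ω} (hS : ∀ i, MeasurableSet (S i)) (hcover : ∀ ω, q < X ω → ∃ i, ω ∈ S i)
    (hSα : ∀ i, μ.real (S i ∩ {ω | q < X ω}) ≤ α i)
    (hup : ∀ i, ∀ p ∈ Ico (1 - β) 1, ∀ ω ∈ tailSet μ X p, ∀ ω' ∈ S i, ω' ∉ tailSet μ X p →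
      ω ∈ S i) :
    ∃ Xs : ι → Ω → ℝ, (∀ i, Measurable (Xs i)) ∧ (∀ ω, X ω ≤ ∑ i, Xs i ω) ∧
      (∀ i, UpBeta μ (Xs i) X β) ∧ ∑ i, Qleft μ (Xs i) (α i) ≤ q := by
  have hcard : (Fintype.card ι : ℝ) ≠ 0 := by simp
  have hconst : ∑ _i : ι, q / Fintype.card ι = q := by
    rw [Finset.sum_const, Finset.card_univ, nsmul_eq_mul]
    field_simp
  have hnn : ∀ i ω, 0 ≤ (S i).indicator (fun ω => max (X ω - q) 0) ω := fun i ω =>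
    indicator_nonneg (fun _ _ => le_max_right _ _) ω
  have hmeas : ∀ i, Measurable fun ω =>
      q / Fintype.card ι + (S i).indicator (fun ω => max (X ω - q) 0) ω := fun i =>
    (((hX.sub_const q).max measurable_const).indicator (hS i)).const_add _
  refine ⟨fun i ω => q / Fintype.card ι + (S i).indicator (fun ω => max (X ω - q) 0) ω,
    hmeas, fun ω => ?_, fun i => ?_, ?_⟩
  · rw [Finset.sum_add_distrib, hconst]
    rcases le_or_gt (X ω) q with h | h
    · exact h.trans (le_add_of_nonneg_right (Finset.sum_nonneg fun i _ => hnn i ω))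
    · obtain ⟨i, hi⟩ := hcover ω h
      have h1 := Finset.single_le_sum (fun i _ => hnn i ω) (Finset.mem_univ i)
      rw [indicator_of_mem hi] at h1
      have h2 := le_max_left (X ω - q) 0
      linarith
  · refine (upBeta_iff (hmeas i) hX).2 fun p hp ω hω ω' hω' => ?_
    refine add_le_add_right ?_ _
    by_cases h' : ω' ∈ S i
    · rw [indicator_of_mem h', indicator_of_mem (hup i p hp ω hω ω' h' hω')]
      have hlt : X ω' ≤ X ω := (not_lt.1 hω').trans (le_of_lt hω)
      exact max_le_max_right _ (by linarith)
    · rw [indicator_of_notMem h']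
      exact hnn i ω
  · refine (Finset.sum_le_sum fun i _ =>
      Qleft_le_of_le_measure (hmeas i) (hα i) ?_).trans hconst.le
    have hm : MeasurableSet (S i ∩ {ω | q < X ω}) := (hS i).inter (hX measurableSet_Ioi)
    have hc := probReal_compl_eq_one_sub (μ := μ) hm
    have hsub : (S i ∩ {ω | q < X ω})ᶜ ⊆ {ω | q / Fintype.card ι +
        (S i).indicator (fun ω => max (X ω - q) 0) ω ≤ q / Fintype.card ι} := by
      intro ω hω
      have h0 : (S i).indicator (fun ω => max (X ω - q) 0) ω = 0 := by
        by_cases hi : ω ∈ S i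
        · rw [indicator_of_mem hi, max_eq_right]
          have : ¬ q < X ω := fun h => hω ⟨hi, h⟩
          linarith
        · exact indicator_of_notMem hi _
      simp [h0]
    have := measureReal_mono (μ := μ) hsub
    rw [← measureReal_def]
    linarith [hSα i]

theorem exists_partial_sum_lt_le {n : ℕ} (w : Fin n → ℝ) {t : ℝ} (h0 : 0 < t)
    (ht : t ≤ ∑ i, w i) :
    ∃ k, ∑ j ∈ Finset.Iio k, w j < t ∧ t ≤ ∑ j ∈ Finset.Iio k, w j + w k := by
  induction n with
  | zero => simp at ht; linarith
  | succ n ih =>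
    rw [Fin.sum_univ_castSucc] at ht
    rcases le_or_gt t (∑ i : Fin n, w i.castSucc) with h | h
    · obtain ⟨k, hk⟩ := ih (fun i => w i.castSucc) h
      refine ⟨k.castSucc, ?_⟩
      rwa [← Fin.map_castSuccEmb_Iio, Finset.sum_map]
    · refine ⟨Fin.last n, ?_⟩
      rw [Fin.Iio_last_eq_map, Finset.sum_map]
      exact ⟨h, ht⟩

theorem exists_allocation_le_Qleft [IsProbabilityMeasure μ] {X : Ω → ℝ} (hX : Measurable X)
    (hXc : ContinuouslyDistributed μ X) {n : ℕ} {α : Fin n → ℝ} (hα : ∀ i, 0 < α i)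
    (hα1 : ∀ i, α i < 1) {β γ : ℝ} (hβ : 0 ≤ β) (hγ : γ < 1) {i₀ : Fin n}
    (hi₀ : ∀ i, α i ≤ α i₀) (hγeq : γ = min β (α i₀) + ∑ i, max (α i - β) 0) (hγ0 : 0 < γ) :
    ∃ Xs : Fin n → Ω → ℝ, (∀ i, Measurable (Xs i)) ∧ (∀ ω, X ω ≤ ∑ i, Xs i ω) ∧
      (∀ i, UpBeta μ (Xs i) X β) ∧ ∑ i, Qleft μ (Xs i) (α i) ≤ Qleft μ X γ := by
  have : Nonempty (Fin n) := ⟨i₀⟩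
  have hQ := le_measure_le_Qleft (μ := μ) hX hγ0
  rcases le_or_gt (α i₀) β with hle | hlt
  · have hγα : γ = α i₀ := by
      rw [hγeq, min_eq_right hle, Finset.sum_eq_zero, add_zero]
      exact fun i _ => max_eq_right (by linarith [hi₀ i])
    have hQc := probReal_compl_eq_one_sub (μ := μ)
      (s := {ω | X ω ≤ Qleft μ X γ}) (hX measurableSet_Iic)
    have he : {ω | X ω ≤ Qleft μ X γ}ᶜ = {ω | Qleft μ X γ < X ω} := by
      ext ω
      simp
    rw [he] at hQc
    rw [← measureReal_def] at hQ
    refine exists_allocation hX hα1 (S := fun i => {_ω | i = i₀}) (fun i => .const _)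
      (fun ω _ => ⟨i₀, rfl⟩) (fun i => ?_) fun i p _ ω _ ω' hω' _ => hω'
    by_cases hi : i = i₀
    · refine (measureReal_mono inter_subset_right).trans ?_
      rw [hi]
      linarith
    · simp [hi, (hα i).le]
  · rw [min_eq_left hlt.le] at hγeq
    set w : Fin n → ℝ := fun i => max (α i - β) 0
    set c : Fin n → ℝ := fun k => ∑ j ∈ Finset.Iio k, w j
    have hw : ∀ i, 0 ≤ w i := fun i => le_max_right _ _
    have hc0 : ∀ k, 0 ≤ c k := fun k => Finset.sum_nonneg fun j _ => hw j
    have hcw : ∀ k, c k + w k ≤ ∑ i, w i := fun k => by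
      rw [add_comm, ← Finset.sum_insert (by simp)]
      exact Finset.sum_le_univ_sum_of_nonneg hw
    set G : Ω → ℝ := fun ω => cdf (μ.map X) (X ω) with hG
    have hGm : Measurable G := measurable_cdf_comp hX
    refine exists_allocation hX hα1 (S := fun i => {_ω | β < α i} ∩
      ({ω | 1 - β ≤ G ω} ∪ {ω | G ω ∈ Ico (1 - β - c i - w i) (1 - β - c i)}))
      (fun i => (MeasurableSet.const _).inter
        ((hGm measurableSet_Ici).union (hGm measurableSet_Ico)))
      (fun ω hω => ?_) (fun i => ?_) fun i p hp ω hω ω' hω' _ => ?_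
    · rcases le_or_gt (1 - β) (G ω) with h | h
      · exact ⟨i₀, hlt, Or.inl h⟩
      have hGω : 1 - γ ≤ G ω := by
        rw [toReal_measure_le_eq_cdf hX] at hQ
        exact hQ.trans (monotone_cdf _ (le_of_lt hω))
      obtain ⟨k, hk1, hk2⟩ := exists_partial_sum_lt_le w (t := 1 - β - G ω) (by linarith)
        (by linarith)
      change c k < _ at hk1
      change _ ≤ c k + w k at hk2
      refine ⟨k, ?_, Or.inr ⟨by linarith, by linarith⟩⟩
      have hwk : 0 < w k := by linarith
      have := (lt_max_iff.1 hwk).resolve_right (lt_irrefl _)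
      simpa using this
    · by_cases hi : β < α i
      · have hwi : w i = α i - β := max_eq_left (by linarith)
        have h1 := hcw i
        have h2 := hc0 i
        have h3 := hw i
        refine (measureReal_mono (inter_subset_left.trans inter_subset_right)).trans
          ((measureReal_union_le _ _).trans ?_)
        rw [measureReal_le_cdf_comp hX hXc ⟨by linarith [hα1 i], by linarith⟩,
          measureReal_cdf_comp_mem_Ico hX hXc (by linarith) (by linarith) (by linarith)]
        linarith
      · simp [hi, (hα i).le]
    · exact ⟨hω'.1, Or.inl (hp.1.trans (lt_cdf_of_mem_tailSet hX hp.2 hω).le)⟩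

end

/-- Theorem 6.1 (Wang–Zitikis, "Weak comonotonicity"). For a continuously distributed `X`
on an atomless probability space, `α₁, …, α_n > 0` with `∑ αᵢ < 1` and `β ∈ [0,1]`,
the constrained risk-sharing value satisfies `V_β(X) = Q_γ(X)` with
`γ = min(β, max_i αᵢ) + ∑ᵢ (αᵢ − β)₊`. -/
theorem risk_sharing_value_eq {Ω : Type*} [MeasurableSpace Ω]
    (μ : Measure Ω) [IsProbabilityMeasure μ] (hμ : Atomless μ)
    (X : Ω → ℝ) (hX : Measurable X) (hXc : ContinuouslyDistributed μ X)
    (n : ℕ) (hn : 0 < n) (α : Fin n → ℝ) (hα : ∀ i, 0 < α i)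
    (hsum : ∑ i, α i < 1) (β : ℝ) (hβ : β ∈ Set.Icc (0 : ℝ) 1) :
    sInf {v : ℝ | ∃ Xs : Fin n → Ω → ℝ, (∀ i, Measurable (Xs i)) ∧
        (∀ ω, X ω ≤ ∑ i, Xs i ω) ∧ (∀ i, UpBeta μ (Xs i) X β) ∧
        v = ∑ i, Qleft μ (Xs i) (α i)} =
      Qleft μ X (min β (⨆ i, α i) + ∑ i, max (α i - β) 0) := by
  have : Nonempty (Fin n) := ⟨⟨0, hn⟩⟩
  obtain ⟨i₀, hi₀⟩ := exists_eq_ciSup_of_finite (f := α)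
  have hmax : ∀ i, α i ≤ α i₀ := fun i => by
    rw [hi₀]
    exact le_ciSup (finite_range α).bddAbove i
  rw [← hi₀]
  have hα1 : ∀ i, α i < 1 := fun i =>
    (Finset.single_le_sum (fun j _ => (hα j).le) (Finset.mem_univ i)).trans_lt hsum
  set m := min β (α i₀) with hm
  have hm0 : 0 ≤ m := le_min hβ.1 (hα i₀).le
  have hmα : m ≤ α i₀ := min_le_right _ _
  have hw : ∀ i, max (α i - β) 0 = max (α i - m) 0 := fun i => by
    rcases le_total β (α i₀) with h | h
    · rw [hm, min_eq_left h]
    · rw [hm, min_eq_right h, max_eq_right, max_eq_right] <;> linarith [hmax i]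
  have hγ0 : 0 < m + ∑ i, max (α i - m) 0 := by
    have h1 := Finset.single_le_sum (f := fun i => max (α i - m) 0)
      (fun j _ => le_max_right _ _) (Finset.mem_univ i₀)
    have h2 := le_max_left (α i₀ - m) 0
    have h3 := hα i₀
    linarith
  have hγ1 : m + ∑ i, max (α i - m) 0 < 1 := by
    refine lt_of_le_of_lt ?_ hsum
    rw [← Finset.add_sum_erase _ _ (Finset.mem_univ i₀),
      ← Finset.add_sum_erase _ α (Finset.mem_univ i₀), max_eq_left (by linarith), ← add_assoc]
    refine add_le_add (by linarith) (Finset.sum_le_sum fun i _ => ?_)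
    exact max_le (by linarith) (hα i).le
  obtain ⟨Xs, h1, h2, h3, h4⟩ := exists_allocation_le_Qleft hX hXc hα hα1 hβ.1
    (γ := m + ∑ i, max (α i - m) 0) hγ1 hmax (by simp only [hw, hm]) hγ0
  simp only [hw]
  have hlower : ∀ v ∈ {v : ℝ | ∃ Xs : Fin n → Ω → ℝ, (∀ i, Measurable (Xs i)) ∧
      (∀ ω, X ω ≤ ∑ i, Xs i ω) ∧ (∀ i, UpBeta μ (Xs i) X β) ∧
      v = ∑ i, Qleft μ (Xs i) (α i)}, Qleft μ X (m + ∑ i, max (α i - m) 0) ≤ v := by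
    rintro v ⟨Ys, hYs, hle, hup, rfl⟩
    exact Qleft_sum_le hX hXc hα hm0 (hmα.trans_lt (hα1 i₀)) (min_le_left _ _) hγ1 hYs hle hup
  exact le_antisymm ((csInf_le ⟨_, hlower⟩ ⟨Xs, h1, h2, h3, rfl⟩).trans h4)
    (le_csInf ⟨_, Xs, h1, h2, h3, rfl⟩ hlower)
end

section
/- Let X be a continuously distributed random variable on an atomless probability space, let β ∈ (0,1), let Y be a random variable with Y ↑_β X, and set B = A^X_{1−β}. Then, almost surely, B ⊆ {Y ≥ Q_β(Y)} and B^c ⊆ {Y ≤ Q_β(Y)}. -/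
open MeasureTheory Set

open ProbabilityTheory Filter Topology

theorem UpBeta.le_of_mem_tailSet {Ω : Type*} [MeasurableSpace Ω] {μ : Measure Ω} {X Y : Ω → ℝ}
    (hX : Measurable X) (hY : Measurable Y) {β : ℝ} (hβ : 0 < β) (hup : UpBeta μ Y X β)
    {ω ω' : Ω} (hω : ω ∈ tailSet μ X (1 - β)) (hω' : ω' ∉ tailSet μ X (1 - β)) :
    Y ω' ≤ Y ω := by
  have h := hup (1 - β) ⟨le_rfl, by linarith⟩ ω hω ω' hω'
  have hm : Measurable fun q : Ω × Ω => (Y q.1 - Y q.2) * (X q.1 - X q.2) := by fun_prop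
  rw [WeaklyComonotonic, Measure.dirac_prod_dirac,
    integral_dirac' _ _ hm.stronglyMeasurable] at h
  have hlt : X ω' < X ω := (not_lt.mp hω').trans_lt hω
  exact sub_nonneg.mp (nonneg_of_mul_nonneg_left h (sub_pos.mpr hlt))

theorem StieltjesFunction.le_apply_csInf (F : StieltjesFunction ℝ) {p : ℝ} {S : Set ℝ}
    (hne : S.Nonempty) (hS : ∀ x ∈ S, p ≤ F x) : p ≤ F (sInf S) := by
  have hF : Tendsto F (𝓝[>] sInf S) (𝓝 (F (sInf S))) :=
    (F.right_continuous (sInf S)).tendsto.mono_left (nhdsWithin_mono _ Ioi_subset_Ici_self)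
  refine ge_of_tendsto hF ?_
  filter_upwards [self_mem_nhdsWithin] with y hy
  obtain ⟨x, hxS, hxy⟩ := exists_lt_of_csInf_lt hne hy
  exact (hS x hxS).trans (F.mono hxy.le)

theorem bddBelow_setOf_le_cdf (ν : Measure ℝ) {p : ℝ} (hp : 0 < p) :
    BddBelow {x : ℝ | p ≤ cdf ν x} := by
  obtain ⟨a, ha⟩ := ((tendsto_cdf_atBot ν).eventually_lt_const hp).exists
  exact ⟨a, fun x hx => le_of_not_gt fun hxa =>
    (ha.trans_le hx).not_ge (monotone_cdf ν hxa.le)⟩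

theorem exists_lt_cdf (ν : Measure ℝ) {p : ℝ} (hp : p < 1) : ∃ x, p < cdf ν x :=
  ((tendsto_cdf_atTop ν).eventually_const_lt hp).exists

theorem cdf_csInf_setOf_lt_cdf (ν : Measure ℝ) [IsProbabilityMeasure ν]
    (hν : ∀ x, ν {x} = 0) {p : ℝ} (hp₀ : 0 < p) (hp₁ : p < 1) :
    cdf ν (sInf {x | p < cdf ν x}) = p := by
  set v := sInf {x | p < cdf ν x}
  refine le_antisymm ?_
    (StieltjesFunction.le_apply_csInf _ (exists_lt_cdf ν hp₁) fun x hx => le_of_lt hx)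
  have hbdd : BddBelow {x | p < cdf ν x} :=
    (bddBelow_setOf_le_cdf ν hp₀).mono (ofPred_subset_ofPred.mpr fun _ => le_of_lt)
  have hleft : Function.leftLim (cdf ν) v = cdf ν v := by
    refine le_antisymm ((monotone_cdf ν).leftLim_le le_rfl) ?_
    have h := hν v
    rw [← measure_cdf ν, StieltjesFunction.measure_singleton, ENNReal.ofReal_eq_zero] at h
    linarith
  refine le_of_tendsto (hleft ▸ (monotone_cdf ν).tendsto_leftLim v) ?_
  filter_upwards [self_mem_nhdsWithin] with y hy
  exact not_lt.mp fun h => (csInf_le hbdd h).not_gt hy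

theorem cdf_map_apply {Ω : Type*} [MeasurableSpace Ω] (μ : Measure Ω) [IsProbabilityMeasure μ]
    {Z : Ω → ℝ} (hZ : Measurable Z) (x : ℝ) :
    cdf (μ.map Z) x = (μ {ω | Z ω ≤ x}).toReal := by
  have := Measure.isProbabilityMeasure_map (μ := μ) hZ.aemeasurable
  rw [cdf_eq_real, map_measureReal_apply hZ measurableSet_Iic]
  rfl

theorem ContinuouslyDistributed.measure_compl_tailSet {Ω : Type*} [MeasurableSpace Ω]
    {μ : Measure Ω} [IsProbabilityMeasure μ] {X : Ω → ℝ} (hX : Measurable X)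
    (hXc : ContinuouslyDistributed μ X) {p : ℝ} (hp₀ : 0 < p) (hp₁ : p < 1) :
    (μ (tailSet μ X p)ᶜ).toReal = p := by
  have := Measure.isProbabilityMeasure_map (μ := μ) hX.aemeasurable
  have hν : ∀ x, μ.map X {x} = 0 := fun x => by
    rw [Measure.map_apply hX (measurableSet_singleton x)]
    exact hXc x
  have h := cdf_csInf_setOf_lt_cdf (μ.map X) hν hp₀ hp₁
  simp only [cdf_map_apply μ hX] at h
  have hc : (tailSet μ X p)ᶜ = {ω | X ω ≤ VaR μ X p} := by
    ext ω
    simp [tailSet]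
  rwa [hc]

/-- Lemma 6.2(i) (Wang–Zitikis, "Weak comonotonicity"). If `Y ↑_β X` and
`B = A^X_{1−β}`, then almost surely `B ⊆ {Y ≥ Q_β(Y)}` and `Bᶜ ⊆ {Y ≤ Q_β(Y)}`. -/
theorem upBeta_tail_ae_bounds {Ω : Type*} [MeasurableSpace Ω]
    (μ : Measure Ω) [IsProbabilityMeasure μ] (hμ : Atomless μ)
    (X : Ω → ℝ) (hX : Measurable X) (hXc : ContinuouslyDistributed μ X)
    (β : ℝ) (hβ : β ∈ Set.Ioo (0 : ℝ) 1)
    (Y : Ω → ℝ) (hY : Measurable Y) (hup : UpBeta μ Y X β) :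
    ∀ᵐ ω ∂μ, (ω ∈ tailSet μ X (1 - β) → Qleft μ Y β ≤ Y ω) ∧
      (ω ∉ tailSet μ X (1 - β) → Y ω ≤ Qleft μ Y β) := by
  have hp₀ : 0 < 1 - β := by linarith [hβ.2]
  have hp₁ : 1 - β < 1 := by linarith [hβ.1]
  have hB := hXc.measure_compl_tailSet hX hp₀ hp₁
  have hle {ω ω' : Ω} := hup.le_of_mem_tailSet hX hY hβ.1 (ω := ω) (ω' := ω')
  have hbdd : BddBelow {x | 1 - β ≤ (μ {ω | Y ω ≤ x}).toReal} := by
    simpa only [cdf_map_apply μ hY] using bddBelow_setOf_le_cdf (μ.map Y) hp₀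
  have hQ : 1 - β ≤ (μ {ω | Y ω ≤ Qleft μ Y β}).toReal := by
    have hne : {x | 1 - β ≤ cdf (μ.map Y) x}.Nonempty :=
      (exists_lt_cdf (μ.map Y) hp₁).imp fun _ => le_of_lt
    have h := (cdf (μ.map Y)).le_apply_csInf hne fun _ hx => hx
    simpa only [Qleft, cdf_map_apply μ hY] using h
  have hnull : μ ((tailSet μ X (1 - β))ᶜ \ {ω | Y ω ≤ Qleft μ Y β}) = 0 := by
    rcases ((tailSet μ X (1 - β))ᶜ \ {ω | Y ω ≤ Qleft μ Y β}).eq_empty_or_nonempty with h | h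
    · rw [h, measure_empty]
    · obtain ⟨ω', hω', hlt⟩ := h
      have hsub : {ω | Y ω ≤ Qleft μ Y β} ⊆ (tailSet μ X (1 - β))ᶜ := fun ω hω hmem =>
        hlt ((hle hmem hω').trans hω)
      rw [measure_sdiff hsub (hY measurableSet_Iic).nullMeasurableSet (measure_ne_top μ _),
        tsub_eq_zero_iff_le, ← ENNReal.toReal_le_toReal (measure_ne_top μ _) (measure_ne_top μ _),
        hB]
      exact hQ
  filter_upwards [measure_eq_zero_iff_ae_notMem.mp hnull] with ω hω
  refine ⟨fun hmem => csInf_le hbdd ?_, fun hmem => by_contra fun h => hω ⟨hmem, h⟩⟩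
  rw [mem_ofPred_eq, ← hB]
  exact ENNReal.toReal_mono (measure_ne_top μ _) (measure_mono fun ω' hω' => hle hmem hω')
end
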